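/- arXiv:0705.3839 — 3 statements merged into one kernel-verified Lean document; each statement's English description precedes it below -/
import Mathlib

section
/- Let V = V^+ ⊕ V^− and V' = V'^+ ⊕ V'^− be isometric hyperbolic spaces over F, and let 𝒱 = {V_i}_{i=0,…,k} and 𝒱' = {V_i'}_{i=0,…,k} be isometric self-dual flags of V and V' respectively such that V_{⌊k/2⌋} ⊆ V^+ and V_{⌊k/2⌋}' ⊆ V'^+. Then an isometry φ : E → E' between subspaces E ⊆ V and E' ⊆ V' can be extended to an isometry φ_V : V → V' satisfying φ_V(V^+) = V'^+, φ_V(V^−) = V'^−, and φ_V(V_i) = V_i' for all i, if and only if φ(E ∩ V^+) = E' ∩ V'^+, φ(E ∩ V^−) = E' ∩ V'^−, and the induced linear bijection φ̃ = φ̃_{V^+,V^−} : P_{V^+,V^−}(E) → P_{V'^+,V'^−}(E') is an isometry satisfying φ̃(P_{V^+,V^−}(E) ∩ V_i) = P_{V'^+,V'^−}(E') ∩ V_i' for i = 1,…,k. -/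
open Module

namespace Witt

variable {F V V' : Type*} [Field F] [AddCommGroup V] [Module F V]
  [AddCommGroup V'] [Module F V']

/-- A linear equivalence `φ : E ≃ E'` between subspaces is an isometry if it
preserves the ambient bilinear forms. -/
def IsIsometryOn (B : LinearMap.BilinForm F V) (B' : LinearMap.BilinForm F V')
    (E : Submodule F V) (E' : Submodule F V') (φ : E ≃ₗ[F] E') : Prop :=
  ∀ u v : E, B' (φ u : V') (φ v : V') = B (u : V) (v : V)

/-- A linear equivalence of the whole spaces which preserves the forms. -/
def IsIsometry (B : LinearMap.BilinForm F V) (B' : LinearMap.BilinForm F V')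
    (ψ : V ≃ₗ[F] V') : Prop :=
  ∀ u v : V, B' (ψ u) (ψ v) = B u v

/-- The two metric spaces `(V,B)` and `(V',B')` are isometric. -/
def AreIsometric (B : LinearMap.BilinForm F V) (B' : LinearMap.BilinForm F V') : Prop :=
  ∃ ψ : V ≃ₗ[F] V', IsIsometry B B' ψ

/-- The subspaces `N ⊆ V` and `N' ⊆ V'` are isometric with respect to the
restrictions of the ambient forms. -/
def SubIsometric (B : LinearMap.BilinForm F V) (B' : LinearMap.BilinForm F V')
    (N : Submodule F V) (N' : Submodule F V') : Prop :=
  ∃ ψ : N ≃ₗ[F] N', IsIsometryOn B B' N N' ψ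

/-- A subspace is totally isotropic. -/
def TotIsotropic (B : LinearMap.BilinForm F V) (N : Submodule F V) : Prop :=
  ∀ u ∈ N, ∀ v ∈ N, B u v = 0

end Witt

open Module Witt

/-- The sum of the projections of `E` to the two components of the
decomposition `V = A ⊕ B`: `P_{A,B}(E) = ((E+B) ∩ A) ⊕ ((E+A) ∩ B)`. -/
def Pproj {F V : Type*} [Field F] [AddCommGroup V] [Module F V]
    (A Bs E : Submodule F V) : Submodule F V :=
  ((E ⊔ Bs) ⊓ A) ⊔ ((E ⊔ A) ⊓ Bs)

section PartialIsomorphisms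

variable {F X Y U : Type*} [Field F] [AddCommGroup X] [Module F X]
  [AddCommGroup Y] [Module F Y] [AddCommGroup U] [Module F U]

/-- A linear map that is injective on `N` preserves the dimension of `N`. -/
theorem finrank_map_of_injOn {f : X →ₗ[F] Y} {N : Submodule F X}
    (hf : ∀ x ∈ N, f x = 0 → x = 0) : finrank F (N.map f) = finrank F N := by
  rw [← LinearMap.range_domRestrict]
  refine LinearMap.finrank_range_of_inj ((injective_iff_map_eq_zero _).2 fun x hx => ?_)
  exact Subtype.ext (hf x x.2 hx)

/-- If the partial isomorphism with graph `G` matches `A` with `A'`, and `A`, `A'` have the same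
dimension, then `A` is contained in the domain of `G` iff `A'` is contained in its range. -/
theorem le_map_fst_iff_le_map_snd [FiniteDimensional F X] [FiniteDimensional F Y]
    {G : Submodule F (X × Y)} (hG : ∀ g ∈ G, g.1 = 0 ↔ g.2 = 0)
    {A : Submodule F X} {A' : Submodule F Y} (hA : ∀ g ∈ G, g.1 ∈ A ↔ g.2 ∈ A')
    (hdim : finrank F A = finrank F A') :
    A ≤ G.map (LinearMap.fst F X Y) ↔ A' ≤ G.map (LinearMap.snd F X Y) := by
  set N := G ⊓ A.comap (LinearMap.fst F X Y) with hN
  have h₁ : G.map (LinearMap.fst F X Y) ⊓ A = N.map (LinearMap.fst F X Y) :=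
    Submodule.map_inf_eq_map_inf_comap
  have hN' : N = G ⊓ A'.comap (LinearMap.snd F X Y) := by
    ext g
    simp only [hN, Submodule.mem_inf, Submodule.mem_comap, LinearMap.fst_apply,
      LinearMap.snd_apply]
    exact and_congr_right fun hg => hA g hg
  have h₂ : G.map (LinearMap.snd F X Y) ⊓ A' = N.map (LinearMap.snd F X Y) := by
    rw [hN']
    exact Submodule.map_inf_eq_map_inf_comap
  have e₁ : finrank F ↥(G.map (LinearMap.fst F X Y) ⊓ A) = finrank F N := by
    rw [h₁]
    exact finrank_map_of_injOn fun g hg h => Prod.ext h ((hG g hg.1).1 h)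
  have e₂ : finrank F ↥(G.map (LinearMap.snd F X Y) ⊓ A') = finrank F N := by
    rw [h₂]
    exact finrank_map_of_injOn fun g hg h => Prod.ext ((hG g hg.1).2 h) h
  rw [← inf_eq_right, ← inf_eq_right]
  constructor
  · intro h
    refine Submodule.eq_of_le_of_finrank_eq inf_le_right ?_
    rw [e₂, ← e₁, h, hdim]
  · intro h
    refine Submodule.eq_of_le_of_finrank_eq inf_le_right ?_
    rw [e₁, ← e₂, h, hdim]

/-- Rank-nullity for the restriction of a linear map to a subspace. -/
theorem finrank_map_add_finrank_inf_ker [FiniteDimensional F X] (f : X →ₗ[F] U)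
    (A : Submodule F X) :
    finrank F (A.map f) + finrank F ↥(A ⊓ LinearMap.ker f) = finrank F A := by
  rw [← LinearMap.finrank_range_add_finrank_ker (f.domRestrict A), LinearMap.range_domRestrict,
    LinearMap.ker_domRestrict, ← Submodule.map_comap_subtype]
  congr 1
  exact finrank_map_of_injOn fun x _ hx => Subtype.ext hx

/-- Subspaces of equal dimension whose images have equal dimension meet the kernels in equal
dimension. -/
theorem finrank_inf_ker_eq [FiniteDimensional F X] [FiniteDimensional F Y]
    {f : X →ₗ[F] U} {f' : Y →ₗ[F] U} {A : Submodule F X} {A' : Submodule F Y}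
    (hdim : finrank F A = finrank F A') (hmap : A.map f = A'.map f') :
    finrank F ↥(A ⊓ LinearMap.ker f) = finrank F ↥(A' ⊓ LinearMap.ker f') := by
  have h₁ := finrank_map_add_finrank_inf_ker f A
  have h₂ := finrank_map_add_finrank_inf_ker f' A'
  rw [hmap] at h₁
  lia

/-- A flag-preserving partial isomorphism `G` between flagged spaces over `U` that is not
everywhere defined can be extended by one vector. -/
theorem exists_flag_extension_vector [FiniteDimensional F X] [FiniteDimensional F Y]
    {𝒲 : ℕ → Submodule F X} {𝒲' : ℕ → Submodule F Y}
    (h0 : 𝒲 0 = ⊥) (h0' : 𝒲' 0 = ⊥) {n : ℕ} (hn : 𝒲 n = ⊤)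
    (hdim : ∀ i, finrank F (𝒲 i) = finrank F (𝒲' i))
    {f : X →ₗ[F] U} {f' : Y →ₗ[F] U} (hmap : ∀ i, (𝒲 i).map f = (𝒲' i).map f')
    {G : Submodule F (X × Y)} (hG : ∀ g ∈ G, ∀ i, g.1 ∈ 𝒲 i ↔ g.2 ∈ 𝒲' i)
    (hGf : ∀ g ∈ G, f g.1 = f' g.2) (hne : G.map (LinearMap.fst F X Y) ≠ ⊤) :
    ∃ i, (∀ j < i, 𝒲 j ≤ G.map (LinearMap.fst F X Y)) ∧
      ∃ w ∈ 𝒲 i, ∃ w' ∈ 𝒲' i, w ∉ G.map (LinearMap.fst F X Y) ∧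
        w' ∉ G.map (LinearMap.snd F X Y) ∧ f w = f' w' := by
  classical
  have hG0 : ∀ g ∈ G, g.1 = 0 ↔ g.2 = 0 := fun g hg => by
    simpa [h0, h0'] using hG g hg 0
  have hex : ∃ i, ¬ 𝒲 i ≤ G.map (LinearMap.fst F X Y) :=
    ⟨n, fun h => hne (top_le_iff.1 (hn ▸ h))⟩
  refine ⟨Nat.find hex, fun j hj => not_not.1 (Nat.find_min hex hj), ?_⟩
  have hi := Nat.find_spec hex
  set i := Nat.find hex
  have hK : ∀ g ∈ G, g.1 ∈ 𝒲 i ⊓ LinearMap.ker f ↔ g.2 ∈ 𝒲' i ⊓ LinearMap.ker f' :=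
    fun g hg => by
      simp only [Submodule.mem_inf, LinearMap.mem_ker, hG g hg i, hGf g hg]
  have hKle := le_map_fst_iff_le_map_snd hG0 hK (finrank_inf_ker_eq (hdim i) (hmap i))
  by_cases hc : 𝒲 i ⊓ LinearMap.ker f ≤ G.map (LinearMap.fst F X Y)
  · obtain ⟨w, hw, hwP⟩ := SetLike.not_le_iff_exists.1 hi
    obtain ⟨w', hw', hww'⟩ : f w ∈ (𝒲' i).map f' := hmap i ▸ Submodule.mem_map_of_mem hw
    refine ⟨w, hw, w', hw', hwP, ?_, hww'.symm⟩
    rintro ⟨g, hg, rfl⟩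
    have hgi : g.1 ∈ 𝒲 i := (hG g hg i).2 hw'
    have hmem : w - g.1 ∈ 𝒲 i ⊓ LinearMap.ker f := by
      refine ⟨sub_mem hw hgi, ?_⟩
      rw [SetLike.mem_coe, LinearMap.mem_ker, map_sub, hGf g hg, ← hww', LinearMap.snd_apply, sub_self]
    refine hwP ?_
    have := add_mem (hc hmem) (Submodule.mem_map_of_mem (f := LinearMap.fst F X Y) hg)
    simpa using this
  · obtain ⟨w, hw, hwP⟩ := SetLike.not_le_iff_exists.1 hc
    obtain ⟨w', hw', hwP'⟩ := SetLike.not_le_iff_exists.1 (mt hKle.2 hc)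
    exact ⟨w, hw.1, w', hw'.1, hwP, hwP', by
      rw [LinearMap.mem_ker.1 hw.2, LinearMap.mem_ker.1 hw'.2]⟩

/-- Every flag-preserving partial isomorphism between flagged spaces over `U`
extends to an everywhere defined one. -/
theorem exists_flag_equiv_extending [FiniteDimensional F X] [FiniteDimensional F Y]
    {𝒲 : ℕ → Submodule F X} {𝒲' : ℕ → Submodule F Y}
    (h0 : 𝒲 0 = ⊥) (h0' : 𝒲' 0 = ⊥) {n : ℕ} (hn : 𝒲 n = ⊤) (hn' : 𝒲' n = ⊤)
    (hmono : Monotone 𝒲) (hmono' : Monotone 𝒲')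
    (hdim : ∀ i, finrank F (𝒲 i) = finrank F (𝒲' i))
    {f : X →ₗ[F] U} {f' : Y →ₗ[F] U} (hmap : ∀ i, (𝒲 i).map f = (𝒲' i).map f')
    {G₀ : Submodule F (X × Y)} (hG₀ : ∀ g ∈ G₀, ∀ i, g.1 ∈ 𝒲 i ↔ g.2 ∈ 𝒲' i)
    (hGf₀ : ∀ g ∈ G₀, f g.1 = f' g.2) :
    ∃ e : X ≃ₗ[F] Y, (∀ g ∈ G₀, e g.1 = g.2) ∧ (∀ x, f' (e x) = f x) ∧
      ∀ x i, x ∈ 𝒲 i ↔ e x ∈ 𝒲' i := by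
  let S : Set (Submodule F (X × Y)) :=
    {G | G₀ ≤ G ∧ (∀ g ∈ G, ∀ i, g.1 ∈ 𝒲 i ↔ g.2 ∈ 𝒲' i) ∧ ∀ g ∈ G, f g.1 = f' g.2}
  obtain ⟨G, ⟨hle, hG, hGf⟩, hmax⟩ :=
    set_has_maximal_iff_noetherian.2 (inferInstance : IsNoetherian F (X × Y)) S
      ⟨G₀, le_rfl, hG₀, hGf₀⟩
  have hG0 : ∀ g ∈ G, g.1 = 0 ↔ g.2 = 0 := fun g hg => by
    simpa [h0, h0'] using hG g hg 0
  have hfst : G.map (LinearMap.fst F X Y) = ⊤ := by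
    by_contra hne
    obtain ⟨i, hlt, w, hw, w', hw', hwP, hwP', hff⟩ :=
      exists_flag_extension_vector h0 h0' hn hdim hmap hG hGf hne
    have hlt' : ∀ j < i, 𝒲' j ≤ G.map (LinearMap.snd F X Y) := fun j hj =>
      (le_map_fst_iff_le_map_snd hG0 (fun g hg => hG g hg j) (hdim j)).1 (hlt j hj)
    refine hmax (G ⊔ Submodule.span F {(w, w')}) ⟨le_sup_of_le_left hle, ?_, ?_⟩ ?_
    · intro g hg j
      obtain ⟨p, hp, _, hq, rfl⟩ := Submodule.mem_sup.1 hg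
      obtain ⟨c, rfl⟩ := Submodule.mem_span_singleton.1 hq
      by_cases hc : c = 0
      · simpa [hc] using hG p hp j
      rcases lt_or_ge j i with hj | hj
      · have h₁ : p.1 + c • w ∉ 𝒲 j := fun h => hwP <| by
          have := sub_mem (hlt j hj h) (Submodule.mem_map_of_mem (f := LinearMap.fst F X Y) hp)
          rw [LinearMap.fst_apply, add_sub_cancel_left] at this
          exact (Submodule.smul_mem_iff _ hc).1 this
        have h₂ : p.2 + c • w' ∉ 𝒲' j := fun h => hwP' <| by
          have := sub_mem (hlt' j hj h) (Submodule.mem_map_of_mem (f := LinearMap.snd F X Y) hp)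
          rw [LinearMap.snd_apply, add_sub_cancel_left] at this
          exact (Submodule.smul_mem_iff _ hc).1 this
        exact iff_of_false h₁ h₂
      · have h₁ := (𝒲 j).add_mem_iff_left (x := p.1) ((𝒲 j).smul_mem c (hmono hj hw))
        have h₂ := (𝒲' j).add_mem_iff_left (x := p.2) ((𝒲' j).smul_mem c (hmono' hj hw'))
        exact h₁.trans ((hG p hp j).trans h₂.symm)
    · intro g hg
      obtain ⟨p, hp, _, hq, rfl⟩ := Submodule.mem_sup.1 hg
      obtain ⟨c, rfl⟩ := Submodule.mem_span_singleton.1 hq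
      simp [hGf p hp, hff]
    · refine lt_of_le_of_ne le_sup_left fun h => hwP ?_
      have : (w, w') ∈ G := h ▸ Submodule.mem_sup_right (Submodule.mem_span_singleton_self _)
      exact ⟨_, this, rfl⟩
  have hsnd : G.map (LinearMap.snd F X Y) = ⊤ := by
    have := (le_map_fst_iff_le_map_snd hG0 (fun g hg => hG g hg n) (hdim n)).1
      (hfst ▸ le_top)
    rwa [hn', top_le_iff] at this
  have bij₁ : Function.Bijective ((LinearMap.fst F X Y).domRestrict G) := by
    refine ⟨(injective_iff_map_eq_zero _).2 fun g h => ?_, ?_⟩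
    · exact Subtype.ext (Prod.ext h ((hG0 g g.2).1 h))
    · rw [← LinearMap.range_eq_top, LinearMap.range_domRestrict, hfst]
  have bij₂ : Function.Bijective ((LinearMap.snd F X Y).domRestrict G) := by
    refine ⟨(injective_iff_map_eq_zero _).2 fun g h => ?_, ?_⟩
    · exact Subtype.ext (Prod.ext ((hG0 g g.2).2 h) h)
    · rw [← LinearMap.range_eq_top, LinearMap.range_domRestrict, hsnd]
  let e := (LinearEquiv.ofBijective _ bij₁).symm ≪≫ₗ LinearEquiv.ofBijective _ bij₂
  have he : ∀ g ∈ G, e g.1 = g.2 := fun g hg => by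
    have : (LinearEquiv.ofBijective _ bij₁).symm g.1 = ⟨g, hg⟩ :=
      (LinearEquiv.symm_apply_eq _).2 rfl
    simp [e, this]
  have hgraph : ∀ x, (x, e x) ∈ G := fun x => by
    obtain ⟨g, hg, rfl⟩ : x ∈ G.map (LinearMap.fst F X Y) := hfst ▸ Submodule.mem_top
    have : (LinearMap.fst F X Y g, e (LinearMap.fst F X Y g)) = g :=
      Prod.ext rfl (he g hg)
    rwa [this]
  exact ⟨e, fun g hg => he g (hle hg), fun x => (hGf _ (hgraph x)).symm,
    fun x i => hG _ (hgraph x) i⟩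

end PartialIsomorphisms

section HyperbolicFlags

variable {F V V' : Type*} [Field F] [AddCommGroup V] [Module F V]
  [AddCommGroup V'] [Module F V']

theorem mem_dualCoannihilator_map {p : V →ₗ[F] Dual F V'} {C : Submodule F V} {e : V'} :
    e ∈ (C.map p).dualCoannihilator ↔ ∀ x ∈ C, p x e = 0 := by
  simp [Submodule.mem_dualCoannihilator]

theorem apply_mem_iff_of_map_eq {ψ : V ≃ₗ[F] V'} {A : Submodule F V} {A' : Submodule F V'}
    (h : A.map ψ.toLinearMap = A') (x : V) : ψ x ∈ A' ↔ x ∈ A := by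
  rw [← h]
  exact ψ.injective.mem_set_image

theorem map_Pproj (ψ : V ≃ₗ[F] V') (A C E : Submodule F V) :
    (Pproj A C E).map ψ.toLinearMap =
      Pproj (A.map ψ.toLinearMap) (C.map ψ.toLinearMap) (E.map ψ.toLinearMap) := by
  simp only [Pproj, Submodule.map_sup, Submodule.map_inf ψ.toLinearMap ψ.injective]

theorem left_mem_Pproj {A C E : Submodule F V} {x y : V} (hx : x ∈ A) (hy : y ∈ C)
    (h : x + y ∈ E) : x ∈ Pproj A C E :=
  Submodule.mem_sup_left ⟨Submodule.mem_sup.2 ⟨_, h, _, neg_mem hy, add_neg_cancel_right x y⟩, hx⟩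

theorem right_mem_Pproj {A C E : Submodule F V} {x y : V} (hx : x ∈ A) (hy : y ∈ C)
    (h : x + y ∈ E) : y ∈ Pproj A C E :=
  Submodule.mem_sup_right ⟨Submodule.mem_sup.2 ⟨_, h, _, neg_mem hx, by abel⟩, hy⟩

/-- `𝒱` is a self-dual flag of length `k` in the hyperbolic space `P ⊕ M` whose first half is
contained in `P`. -/
structure HyperbolicFlag (B : LinearMap.BilinForm F V) (P M : Submodule F V) (k : ℕ)
    (𝒱 : ℕ → Submodule F V) : Prop where
  symm : ∀ u v, B u v = B v u
  nondegenerate : B.Nondegenerate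
  isotropic_left : TotIsotropic B P
  isotropic_right : TotIsotropic B M
  finrank_eq : finrank F P = finrank F M
  isCompl : IsCompl P M
  bot : 𝒱 0 = ⊥
  le_succ : ∀ i < k, 𝒱 i ≤ 𝒱 (i + 1)
  orthogonal : ∀ i ≤ k, B.orthogonal (𝒱 i) = 𝒱 (k - i)
  half_le : 𝒱 (k / 2) ≤ P

namespace HyperbolicFlag

variable {B : LinearMap.BilinForm F V} {P M : Submodule F V} {k : ℕ} {𝒱 : ℕ → Submodule F V}
  {B' : LinearMap.BilinForm F V'} {P' M' : Submodule F V'} {𝒱' : ℕ → Submodule F V'}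

theorem mono (H : HyperbolicFlag B P M k 𝒱) {i j : ℕ} (hij : i ≤ j) (hj : j ≤ k) :
    𝒱 i ≤ 𝒱 j := by
  induction j, hij using Nat.le_induction with
  | base => exact le_rfl
  | succ j _ ih => exact (ih (by lia)).trans (H.le_succ j (by lia))

theorem le_left (H : HyperbolicFlag B P M k 𝒱) {i : ℕ} (hi : i ≤ k / 2) : 𝒱 i ≤ P :=
  (H.mono hi (Nat.div_le_self k 2)).trans H.half_le

theorem mem_iff (H : HyperbolicFlag B P M k 𝒱) {i : ℕ} (hi : i ≤ k) {z : V} :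
    z ∈ 𝒱 i ↔ ∀ x ∈ 𝒱 (k - i), B x z = 0 := by
  have h := H.orthogonal (k - i) (Nat.sub_le k i)
  rw [Nat.sub_sub_self hi] at h
  rw [← h, LinearMap.BilinForm.mem_orthogonal_iff]

theorem left_le (H : HyperbolicFlag B P M k 𝒱) {i : ℕ} (hi : i ≤ k) (hki : k / 2 < i) :
    P ≤ 𝒱 i := fun x hx =>
  (H.mem_iff hi).2 fun y hy => H.isotropic_left y (H.le_left (by lia) hy) x hx

theorem eq_zero_of_right (H : HyperbolicFlag B P M k 𝒱) {y : V} (hy : y ∈ M)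
    (h : ∀ x ∈ P, B x y = 0) : y = 0 := by
  refine H.nondegenerate.2 y fun z => ?_
  obtain ⟨a, ha, b, hb, rfl⟩ := Submodule.mem_sup.1
    (H.isCompl.sup_eq_top ▸ Submodule.mem_top : z ∈ P ⊔ M)
  rw [map_add, LinearMap.add_apply, h a ha, H.isotropic_right b hb y hy, add_zero]

/-- The part of the flag in `M` is the annihilator of the part of the flag in `P`. -/
theorem right_mem_iff (H : HyperbolicFlag B P M k 𝒱) {i : ℕ} (hi : i ≤ k) {y : V} (hy : y ∈ M) :
    y ∈ 𝒱 (k - i) ↔ ∀ x ∈ P, x ∈ 𝒱 i → B x y = 0 := by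
  rcases le_or_gt i (k / 2) with h | h
  · rw [H.mem_iff (Nat.sub_le k i), Nat.sub_sub_self hi]
    exact ⟨fun hx x _ => hx x, fun hx x hxi => hx x (H.le_left h hxi) hxi⟩
  · constructor
    · intro hyi x hx _
      exact H.isotropic_left x hx y (H.le_left (by lia) hyi)
    · intro hx
      rw [H.eq_zero_of_right hy fun x hxP => hx x hxP (H.left_le hi h hxP)]
      exact zero_mem _

/-- The form identifies `M` with the dual of `P`. -/
theorem exists_dual_equiv [FiniteDimensional F V] (H : HyperbolicFlag B P M k 𝒱) :
    ∃ D : M ≃ₗ[F] Dual F P, ∀ (y : M) (x : P), D y x = B x y := by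
  let d : M →ₗ[F] Dual F P := (B.flip.domRestrict₁₂ M P)
  have hd : Function.Injective d := (injective_iff_map_eq_zero _).2 fun y hy =>
    Subtype.ext <| H.eq_zero_of_right y.2 fun x hx => LinearMap.congr_fun hy ⟨x, hx⟩
  exact ⟨d.linearEquivOfInjective hd (by rw [Subspace.dual_finrank_eq, H.finrank_eq]),
    fun y x => rfl⟩

theorem exists_isometry_of_left [FiniteDimensional F V] [FiniteDimensional F V']
    (H : HyperbolicFlag B P M k 𝒱) (H' : HyperbolicFlag B' P' M' k 𝒱') (g : P ≃ₗ[F] P')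
    (hg : ∀ i ≤ k, ∀ x : P, (x : V) ∈ 𝒱 i ↔ (g x : V') ∈ 𝒱' i) :
    ∃ ψ : V ≃ₗ[F] V', IsIsometry B B' ψ ∧ (∀ x : P, ψ x = g x) ∧ (∀ y ∈ M, ψ y ∈ M') ∧
      P.map ψ.toLinearMap = P' ∧ M.map ψ.toLinearMap = M' ∧
      ∀ i ≤ k, (𝒱 i).map ψ.toLinearMap = 𝒱' i := by
  obtain ⟨D, hD⟩ := H.exists_dual_equiv
  obtain ⟨D', hD'⟩ := H'.exists_dual_equiv
  let h : M ≃ₗ[F] M' := D ≪≫ₗ g.symm.dualMap ≪≫ₗ D'.symm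
  have hgh : ∀ x y, B' (g x) (h y) = B x y := fun x y => by
    rw [← hD', ← hD]
    simp [h]
  let ψ : V ≃ₗ[F] V' := (Submodule.prodEquivOfIsCompl P M H.isCompl).symm ≪≫ₗ
    (g.prodCongr h) ≪≫ₗ Submodule.prodEquivOfIsCompl P' M' H'.isCompl
  have hψ : ∀ (x : P) (y : M), ψ ((x : V) + (y : V)) = (g x : V') + (h y : V') := fun x y => by
    have : (Submodule.prodEquivOfIsCompl P M H.isCompl).symm ((x : V) + (y : V)) = (x, y) :=
      (LinearEquiv.symm_apply_eq _).2 rfl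
    simp [ψ, this]
  have hψP : ∀ x : P, ψ x = g x := fun x => by simpa using hψ x 0
  have hψM : ∀ y : M, ψ y = h y := fun y => by simpa using hψ 0 y
  have hdecomp : ∀ z, ∃ (x : P) (y : M), z = (x : V) + (y : V) := fun z => by
    obtain ⟨a, ha, b, hb, rfl⟩ := Submodule.mem_sup.1
      (H.isCompl.sup_eq_top ▸ Submodule.mem_top : z ∈ P ⊔ M)
    exact ⟨⟨a, ha⟩, ⟨b, hb⟩, rfl⟩
  have hiso : IsIsometry B B' ψ := fun u v => by
    obtain ⟨x, y, rfl⟩ := hdecomp u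
    obtain ⟨z, t, rfl⟩ := hdecomp v
    rw [hψ, hψ]
    simp only [map_add, LinearMap.add_apply]
    rw [H'.isotropic_left _ (g x).2 _ (g z).2, H'.isotropic_right _ (h y).2 _ (h t).2,
      H.isotropic_left _ x.2 _ z.2, H.isotropic_right _ y.2 _ t.2, hgh, H'.symm (h y), hgh,
      H.symm y]
  have hlow : ∀ i ≤ k / 2, (𝒱 i).map ψ.toLinearMap = 𝒱' i := fun i hi => by
    refine le_antisymm ?_ fun x' hx' => ?_
    · rintro _ ⟨x, hx, rfl⟩
      have := (hg i (by lia) ⟨x, H.le_left hi hx⟩).1 hx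
      rwa [← hψP] at this
    · refine ⟨g.symm ⟨x', H'.le_left hi hx'⟩, (hg i (by lia) _).2 (by simpa using hx'), ?_⟩
      exact (hψP _).trans (by simp)
  refine ⟨ψ, hiso, hψP, fun y hy => hψM ⟨y, hy⟩ ▸ (h _).2, ?_, ?_, fun i hi => ?_⟩
  · refine le_antisymm ?_ fun x' hx' => ?_
    · rintro _ ⟨x, hx, rfl⟩
      exact hψP ⟨x, hx⟩ ▸ (g _).2
    · exact ⟨g.symm ⟨x', hx'⟩, (g.symm _).2, (hψP _).trans (by simp)⟩
  · refine le_antisymm ?_ fun x' hx' => ?_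
    · rintro _ ⟨x, hx, rfl⟩
      exact hψM ⟨x, hx⟩ ▸ (h _).2
    · exact ⟨h.symm ⟨x', hx'⟩, (h.symm _).2, (hψM _).trans (by simp)⟩
  · rcases le_or_gt i (k / 2) with h' | h'
    · exact hlow i h'
    ext z'
    obtain ⟨z, rfl⟩ := ψ.surjective z'
    rw [H'.mem_iff hi, ← hlow (k - i) (by lia)]
    have : ψ z ∈ (𝒱 i).map ψ.toLinearMap ↔ z ∈ 𝒱 i := apply_mem_iff_of_map_eq rfl z
    rw [this, H.mem_iff hi]
    constructor
    · rintro hz _ ⟨x, hx, rfl⟩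
      exact (hiso x z).trans (hz x hx)
    · exact fun hz x hx => (hiso x z).symm.trans (hz _ ⟨x, hx, rfl⟩)

/-- The dimensions of the traces of the flag on `P` are determined by the dimensions of the flag. -/
theorem finrank_comap_eq (H : HyperbolicFlag B P M k 𝒱) (H' : HyperbolicFlag B' P' M' k 𝒱')
    (hP : finrank F P = finrank F P') {i : ℕ} (hi : i ≤ k)
    (hdim : finrank F (𝒱 i) = finrank F (𝒱' i)) :
    finrank F ((𝒱 i).comap P.subtype) = finrank F ((𝒱' i).comap P'.subtype) := by
  rcases le_or_gt i (k / 2) with h | h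
  · rw [(Submodule.comapSubtypeEquivOfLe (H.le_left h)).finrank_eq,
      (Submodule.comapSubtypeEquivOfLe (H'.le_left h)).finrank_eq, hdim]
  · rw [Submodule.comap_subtype_eq_top.2 (H.left_le hi h),
      Submodule.comap_subtype_eq_top.2 (H'.left_le hi h), finrank_top, finrank_top, hP]

/-- A family of compatible partial data on the components of two hyperbolic flags, parametrised
by `E`, is induced by an isometry. -/
theorem exists_isometry_extending [FiniteDimensional F V] [FiniteDimensional F V']
    (H : HyperbolicFlag B P M k 𝒱) (H' : HyperbolicFlag B' P' M' k 𝒱')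
    (htop : 𝒱 k = ⊤) (htop' : 𝒱' k = ⊤) (hP : finrank F P = finrank F P')
    (hdim : ∀ i ≤ k, finrank F (𝒱 i) = finrank F (𝒱' i))
    {E : Type*} [AddCommGroup E] [Module F E] [FiniteDimensional F E]
    {a : E →ₗ[F] P} {b : E →ₗ[F] M} {a' : E →ₗ[F] P'} {b' : E →ₗ[F] M'}
    (hpair : ∀ e₁ e₂, B (a e₁) (b e₂) = B' (a' e₁) (b' e₂))
    (ha : ∀ i ≤ k, ∀ e, (a e : V) ∈ 𝒱 i ↔ (a' e : V') ∈ 𝒱' i)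
    (hb : ∀ i ≤ k, ∀ e, (b e : V) ∈ 𝒱 i ↔ (b' e : V') ∈ 𝒱' i) :
    ∃ ψ : V ≃ₗ[F] V', IsIsometry B B' ψ ∧ (∀ e, ψ (a e) = a' e) ∧ (∀ e, ψ (b e) = b' e) ∧
      P.map ψ.toLinearMap = P' ∧ M.map ψ.toLinearMap = M' ∧
      ∀ i ≤ k, (𝒱 i).map ψ.toLinearMap = 𝒱' i := by
  let 𝒲 : ℕ → Submodule F P := fun i => (𝒱 (min i k)).comap P.subtype
  let 𝒲' : ℕ → Submodule F P' := fun i => (𝒱' (min i k)).comap P'.subtype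
  let f : P →ₗ[F] Dual F E := (B.domRestrict₁₂ P M).compl₂ b
  let f' : P' →ₗ[F] Dual F E := (B'.domRestrict₁₂ P' M').compl₂ b'
  have hf : ∀ x e, f x e = B x (b e) := fun x e => rfl
  have hf' : ∀ x e, f' x e = B' x (b' e) := fun x e => rfl
  have hmap : ∀ i, (𝒲 i).map f = (𝒲' i).map f' := fun i => by
    refine Subspace.dualCoannihilator_dualAnnihilator_eq.symm.trans (Eq.trans ?_
      Subspace.dualCoannihilator_dualAnnihilator_eq)
    congr 1
    ext e
    have h₁ := H.right_mem_iff (min_le_right i k) (b e).2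
    have h₂ := H'.right_mem_iff (min_le_right i k) (b' e).2
    have h₃ := h₁.symm.trans ((hb _ (Nat.sub_le _ _) e).trans h₂)
    rw [mem_dualCoannihilator_map, mem_dualCoannihilator_map]
    exact ⟨fun h x hx => h₃.1 (fun z hz hzi => h ⟨z, hz⟩ hzi) x x.2 hx,
      fun h x hx => h₃.2 (fun z hz hzi => h ⟨z, hz⟩ hzi) x x.2 hx⟩
  let G₀ : Submodule F (P × P') := LinearMap.range (a.prod a')
  obtain ⟨g, hgG, hgf, hg⟩ := exists_flag_equiv_extending (𝒲 := 𝒲) (𝒲' := 𝒲') (n := k)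
    (f := f) (f' := f') (G₀ := G₀) (by simp [𝒲, H.bot]) (by simp [𝒲', H'.bot])
    (by simp [𝒲, htop]) (by simp [𝒲', htop'])
    (fun i j hij => Submodule.comap_mono (H.mono (min_le_min_right k hij) (min_le_right _ _)))
    (fun i j hij => Submodule.comap_mono (H'.mono (min_le_min_right k hij) (min_le_right _ _)))
    (fun i => H.finrank_comap_eq H' hP (min_le_right _ _) (hdim _ (min_le_right _ _))) hmap
    (by
      rintro _ ⟨e, rfl⟩ i
      exact ha _ (min_le_right _ _) e)
    (by
      rintro _ ⟨e, rfl⟩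
      exact LinearMap.ext fun e₂ => hpair e e₂)
  obtain ⟨ψ, hiso, hψP, hψM, hmapP, hmapM, hmapV⟩ := H.exists_isometry_of_left H' g
    fun i hi x => by simpa [𝒲, 𝒲', hi] using hg x i
  refine ⟨ψ, hiso, fun e => ?_, fun e => ?_, hmapP, hmapM, hmapV⟩
  · rw [hψP, hgG (a e, a' e) ⟨e, rfl⟩]
  · refine sub_eq_zero.1 (H'.eq_zero_of_right (sub_mem (hψM _ (b e).2) (b' e).2) fun x' hx' => ?_)
    obtain ⟨x, hx⟩ := g.surjective ⟨x', hx'⟩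
    have hx'' : x' = ψ x := by rw [hψP, hx]
    have := LinearMap.congr_fun (hgf x) e
    rw [hf, hf', ← hψP] at this
    rw [hx'', map_sub, hiso, this, sub_self]

end HyperbolicFlag

end HyperbolicFlags

/-- Theorem 4.2: extension of an isometry of subspaces of hyperbolic spaces
preserving the hyperbolic decompositions and compatible self-dual flags. -/
theorem witt_extension_hyperbolic_flag {F V V' : Type*} [Field F]
    [AddCommGroup V] [Module F V] [AddCommGroup V'] [Module F V']
    [FiniteDimensional F V] [FiniteDimensional F V']
    (hchar : (2 : F) ≠ 0)
    (B : LinearMap.BilinForm F V) (B' : LinearMap.BilinForm F V')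
    (hB : ∀ u v : V, B u v = B v u) (hB' : ∀ u v : V', B' u v = B' v u)
    (hnd : B.Nondegenerate) (hnd' : B'.Nondegenerate)
    (hVV' : AreIsometric B B')
    -- hyperbolic decompositions
    (Vp Vm : Submodule F V) (Vp' Vm' : Submodule F V')
    (hVpIso : TotIsotropic B Vp) (hVmIso : TotIsotropic B Vm)
    (hVpMax : ∀ N : Submodule F V, TotIsotropic B N → Vp ≤ N → N = Vp)
    (hVmMax : ∀ N : Submodule F V, TotIsotropic B N → Vm ≤ N → N = Vm)
    (hVpmDim : finrank F ↥Vp = finrank F ↥Vm)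
    (hdisj : Vp ⊓ Vm = ⊥) (hsum : Vp ⊔ Vm = ⊤)
    (hVpIso' : TotIsotropic B' Vp') (hVmIso' : TotIsotropic B' Vm')
    (hVpMax' : ∀ N : Submodule F V', TotIsotropic B' N → Vp' ≤ N → N = Vp')
    (hVmMax' : ∀ N : Submodule F V', TotIsotropic B' N → Vm' ≤ N → N = Vm')
    (hVpmDim' : finrank F ↥Vp' = finrank F ↥Vm')
    (hdisj' : Vp' ⊓ Vm' = ⊥) (hsum' : Vp' ⊔ Vm' = ⊤)
    -- isometric self-dual flags compatible with `V⁺`, `V'⁺`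
    (k : ℕ) (𝒱 : ℕ → Submodule F V) (𝒱' : ℕ → Submodule F V')
    (h0 : 𝒱 0 = ⊥) (hk : 𝒱 k = ⊤) (hmono : ∀ i < k, 𝒱 i ≤ 𝒱 (i + 1))
    (h0' : 𝒱' 0 = ⊥) (hk' : 𝒱' k = ⊤) (hmono' : ∀ i < k, 𝒱' i ≤ 𝒱' (i + 1))
    (hsd : ∀ i ≤ k, B.orthogonal (𝒱 i) = 𝒱 (k - i))
    (hsd' : ∀ i ≤ k, B'.orthogonal (𝒱' i) = 𝒱' (k - i))
    (hflagdim : ∀ i ≤ k, finrank F ↥(𝒱 i) = finrank F ↥(𝒱' i))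
    (hcomp : 𝒱 (k / 2) ≤ Vp) (hcomp' : 𝒱' (k / 2) ≤ Vp')
    -- the isometry of subspaces
    (E : Submodule F V) (E' : Submodule F V')
    (φ : E ≃ₗ[F] E') (hφ : IsIsometryOn B B' E E' φ) :
    (∃ φV : V ≃ₗ[F] V', IsIsometry B B' φV ∧
        (∀ e : E, φV (e : V) = (φ e : V')) ∧
        Vp.map φV.toLinearMap = Vp' ∧ Vm.map φV.toLinearMap = Vm' ∧
        ∀ i ≤ k, (𝒱 i).map φV.toLinearMap = 𝒱' i) ↔
      ((∀ e : E, (e : V) ∈ Vp ↔ (φ e : V') ∈ Vp') ∧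
       (∀ e : E, (e : V) ∈ Vm ↔ (φ e : V') ∈ Vm') ∧
       ∃ ψ : ↥(Pproj Vp Vm E) ≃ₗ[F] ↥(Pproj Vp' Vm' E'),
         -- `ψ` is the induced map `φ̃_{V⁺,V⁻}`
         (∀ (v vA vB : V) (hv : v ∈ E), vA ∈ Vp → vB ∈ Vm → v = vA + vB →
           ∀ (vA' vB' : V'), vA' ∈ Vp' → vB' ∈ Vm' →
             (φ ⟨v, hv⟩ : V') = vA' + vB' →
           ∀ (hAP : vA ∈ Pproj Vp Vm E) (hBP : vB ∈ Pproj Vp Vm E)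
             (hAP' : vA' ∈ Pproj Vp' Vm' E') (hBP' : vB' ∈ Pproj Vp' Vm' E'),
             ψ ⟨vA, hAP⟩ = ⟨vA', hAP'⟩ ∧ ψ ⟨vB, hBP⟩ = ⟨vB', hBP'⟩) ∧
         -- `ψ` is an isometry
         IsIsometryOn B B' (Pproj Vp Vm E) (Pproj Vp' Vm' E') ψ ∧
         -- `ψ` sends `P ∩ Vᵢ` to `P' ∩ Vᵢ'`
         (∀ i, 1 ≤ i → i ≤ k → ∀ x : ↥(Pproj Vp Vm E),
           (x : V) ∈ 𝒱 i ↔ (ψ x : V') ∈ 𝒱' i)) := by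
  have hc : IsCompl Vp Vm := ⟨disjoint_iff.2 hdisj, codisjoint_iff.2 hsum⟩
  have hc' : IsCompl Vp' Vm' := ⟨disjoint_iff.2 hdisj', codisjoint_iff.2 hsum'⟩
  constructor
  · rintro ⟨φV, hiso, hext, hmapP, hmapM, hmapV⟩
    have hE : E.map φV.toLinearMap = E' := by
      refine le_antisymm ?_ fun x' hx' => ?_
      · rintro _ ⟨x, hx, rfl⟩
        exact hext ⟨x, hx⟩ ▸ (φ _).2
      · exact ⟨φ.symm ⟨x', hx'⟩, (φ.symm _).2, (hext _).trans (by simp)⟩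
    have hPE : (Pproj Vp Vm E).map φV.toLinearMap = Pproj Vp' Vm' E' := by
      rw [map_Pproj, hmapP, hmapM, hE]
    refine ⟨fun e => ?_, fun e => ?_,
      φV.submoduleMap (Pproj Vp Vm E) ≪≫ₗ LinearEquiv.ofEq _ _ hPE, ?_, fun u v => hiso u v,
      fun i _ hi x => (apply_mem_iff_of_map_eq (hmapV i hi) x).symm⟩
    · rw [← hext, apply_mem_iff_of_map_eq hmapP]
    · rw [← hext, apply_mem_iff_of_map_eq hmapM]
    · intro v vA vB hv hA hB hvAB vA' vB' hA' hB' hvAB' hAP hBP hAP' hBP'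
      have hsplit : φV vA + φV vB = vA' + vB' := by
        rw [← map_add, ← hvAB, ← hvAB', ← hext]
      have hA₁ := (apply_mem_iff_of_map_eq hmapP vA).2 hA
      have hB₁ := (apply_mem_iff_of_map_eq hmapM vB).2 hB
      have hsub : φV vA - vA' = vB' - φV vB := by
        rw [sub_eq_sub_iff_add_eq_add, hsplit, add_comm]
      have hzero : φV vA - vA' = 0 := Submodule.disjoint_def.1 hc'.disjoint _
        (sub_mem hA₁ hA') (hsub ▸ sub_mem hB' hB₁)
      exact ⟨Subtype.ext (sub_eq_zero.1 hzero),
        Subtype.ext (sub_eq_zero.1 (hsub.symm.trans hzero)).symm⟩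
  · rintro ⟨-, -, ψ, hψ, hψiso, hψV⟩
    have H : HyperbolicFlag B Vp Vm k 𝒱 :=
      ⟨hB, hnd, hVpIso, hVmIso, hVpmDim, hc, h0, hmono, hsd, hcomp⟩
    have H' : HyperbolicFlag B' Vp' Vm' k 𝒱' :=
      ⟨hB', hnd', hVpIso', hVmIso', hVpmDim', hc', h0', hmono', hsd', hcomp'⟩
    have hdimP : finrank F Vp = finrank F Vp' := by
      obtain ⟨e, -⟩ := hVV'
      have h₁ := Submodule.finrank_add_eq_of_isCompl hc
      have h₂ := Submodule.finrank_add_eq_of_isCompl hc'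
      have h₃ := e.finrank_eq
      lia
    have hψV' : ∀ i ≤ k, ∀ x : ↥(Pproj Vp Vm E), (x : V) ∈ 𝒱 i ↔ (ψ x : V') ∈ 𝒱' i := by
      intro i hi x
      rcases Nat.eq_zero_or_pos i with rfl | hpos
      · simp [h0, h0']
      · exact hψV i hpos hi x
    let a : E →ₗ[F] Vp := Vp.projectionOnto Vm hc ∘ₗ E.subtype
    let b : E →ₗ[F] Vm := Vm.projectionOnto Vp hc.symm ∘ₗ E.subtype
    let a' : E →ₗ[F] Vp' := Vp'.projectionOnto Vm' hc' ∘ₗ E'.subtype ∘ₗ φ.toLinearMap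
    let b' : E →ₗ[F] Vm' := Vm'.projectionOnto Vp' hc'.symm ∘ₗ E'.subtype ∘ₗ φ.toLinearMap
    have hab : ∀ e : E, (a e : V) + b e = e := fun e =>
      Submodule.projection_add_projection_eq_self hc (e : V)
    have hab' : ∀ e : E, (a' e : V') + b' e = φ e := fun e =>
      Submodule.projection_add_projection_eq_self hc' (φ e : V')
    have haP : ∀ e, (a e : V) ∈ Pproj Vp Vm E := fun e =>
      left_mem_Pproj (a e).2 (b e).2 (hab e ▸ e.2)
    have hbP : ∀ e, (b e : V) ∈ Pproj Vp Vm E := fun e =>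
      right_mem_Pproj (a e).2 (b e).2 (hab e ▸ e.2)
    have haP' : ∀ e, (a' e : V') ∈ Pproj Vp' Vm' E' := fun e =>
      left_mem_Pproj (a' e).2 (b' e).2 (hab' e ▸ (φ e).2)
    have hbP' : ∀ e, (b' e : V') ∈ Pproj Vp' Vm' E' := fun e =>
      right_mem_Pproj (a' e).2 (b' e).2 (hab' e ▸ (φ e).2)
    have hψab : ∀ e, ψ ⟨a e, haP e⟩ = ⟨a' e, haP' e⟩ ∧ ψ ⟨b e, hbP e⟩ = ⟨b' e, hbP' e⟩ :=
      fun e => hψ e (a e) (b e) e.2 (a e).2 (b e).2 (hab e).symm (a' e) (b' e) (a' e).2 (b' e).2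
        (hab' e).symm (haP e) (hbP e) (haP' e) (hbP' e)
    obtain ⟨φV, hiso, hφa, hφb, hmapP, hmapM, hmapV⟩ := H.exists_isometry_extending H' hk hk' hdimP
      hflagdim (a := a) (b := b) (a' := a') (b' := b')
      (fun e₁ e₂ => by
        have := hψiso ⟨a e₁, haP e₁⟩ ⟨b e₂, hbP e₂⟩
        rw [(hψab e₁).1, (hψab e₂).2] at this
        exact this.symm)
      (fun i hi e => by
        have := hψV' i hi ⟨a e, haP e⟩
        rwa [(hψab e).1] at this)
      (fun i hi e => by
        have := hψV' i hi ⟨b e, hbP e⟩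
        rwa [(hψab e).2] at this)
    refine ⟨φV, hiso, fun e => ?_, hmapP, hmapM, hmapV⟩
    rw [← hab e, map_add, hφa, hφb, hab']
end

section
/- Let V = V^+ ⊕ V̂ ⊕ V^− and V' = V'^+ ⊕ V̂' ⊕ V'^− be Witt decompositions of isometric nonsingular metric spaces V and V' over F, and let 𝒱 = {V_i}_{i=0,…,k} and 𝒱' = {V_i'}_{i=0,…,k} be isometric self-dual flags of V and V' respectively with V_{⌊k/2⌋} ⊆ V^+ and V_{⌊k/2⌋}' ⊆ V'^+. Then an isometry φ : E → E' between subspaces E ⊆ V and E' ⊆ V' can be extended to an isometry φ_V : V → V' with φ_V(V̂) = V̂', φ_V(V^+) = V'^+, φ_V(V^−) = V'^−, and φ_V(V_i) = V_i' for all i, if and only if φ(E ∩ (V^+ + V^−)) = E' ∩ (V'^+ + V'^−), φ(E ∩ (V^− + V̂)) = E' ∩ (V'^− + V̂'), φ(E ∩ (V̂ + V^+)) = E' ∩ (V̂' + V'^+), and the induced map φ̃ = φ̃_{V^+,V̂,V^−} : P_{V^+,V̂,V^−}(E) → P_{V'^+,V̂',V'^−}(E') is an isometry satisfying φ̃(P_{V^+,V̂,V^−}(E)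 ∩ V_i) = P_{V'^+,V̂',V'^−}(E') ∩ V_i' for i = 1,…,k. -/
open Module

open Module Witt

/-- The sum of the projections of `E` onto the three components of the
decomposition `V = A ⊕ B ⊕ C`:
`P_{A,B,C}(E) = ((E+B+C) ∩ A) ⊕ ((E+C+A) ∩ B) ⊕ ((E+A+B) ∩ C)`. -/
def Pproj3 {F V : Type*} [Field F] [AddCommGroup V] [Module F V]
    (A Bs C E : Submodule F V) : Submodule F V :=
  ((E ⊔ Bs ⊔ C) ⊓ A) ⊔ ((E ⊔ C ⊔ A) ⊓ Bs) ⊔ ((E ⊔ A ⊔ Bs) ⊓ C)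

/-- `V = Vp ⊕ Vh ⊕ Vm` is a Witt decomposition of the metric space `(V, B)`:
`Vp` and `Vm` are maximal totally isotropic subspaces of the same dimension,
and `Vh` is an anisotropic subspace orthogonal to both. -/
structure IsWittDecomposition {F V : Type*} [Field F] [AddCommGroup V] [Module F V]
    (B : LinearMap.BilinForm F V) (Vp Vh Vm : Submodule F V) : Prop where
  totIso_p : TotIsotropic B Vp
  totIso_m : TotIsotropic B Vm
  max_p : ∀ N : Submodule F V, TotIsotropic B N → Vp ≤ N → N = Vp
  max_m : ∀ N : Submodule F V, TotIsotropic B N → Vm ≤ N → N = Vm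
  dim_eq : Module.finrank F ↥Vp = Module.finrank F ↥Vm
  aniso : ∀ v ∈ Vh, v ≠ 0 → B v v ≠ 0
  orth_p : ∀ u ∈ Vh, ∀ v ∈ Vp, B u v = 0
  orth_m : ∀ u ∈ Vh, ∀ v ∈ Vm, B u v = 0
  disj_p : Vp ⊓ (Vh ⊔ Vm) = ⊥
  disj_h : Vh ⊓ (Vp ⊔ Vm) = ⊥
  disj_m : Vm ⊓ (Vp ⊔ Vh) = ⊥
  sup_eq : Vp ⊔ Vh ⊔ Vm = ⊤

section LinearAlgebra

variable {F V V' Y : Type*} [Field F] [AddCommGroup V] [Module F V]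
  [AddCommGroup V'] [Module F V'] [AddCommGroup Y] [Module F Y]

theorem LinearMap.exists_eqOn_eqOn (P Q : Submodule F V) (f g : V →ₗ[F] V')
    (hfg : ∀ x ∈ P, x ∈ Q → f x = g x) :
    ∃ h : V →ₗ[F] V', (∀ x ∈ P, h x = f x) ∧ ∀ x ∈ Q, h x = g x := by
  have H : ∀ (x : (⟨P, f.domRestrict P⟩ : V →ₗ.[F] V').domain)
      (y : (⟨Q, g.domRestrict Q⟩ : V →ₗ.[F] V').domain), (x : V) = y →
      (⟨P, f.domRestrict P⟩ : V →ₗ.[F] V') x = (⟨Q, g.domRestrict Q⟩ : V →ₗ.[F] V') y := by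
    rintro ⟨x, hx⟩ ⟨y, hy⟩ hxy
    obtain rfl : x = y := hxy
    exact hfg x hx hy
  obtain ⟨h, hh⟩ := LinearMap.exists_extend (LinearPMap.sup _ _ H).toFun
  refine ⟨h, fun x hx => ?_, fun x hx => ?_⟩
  · have h1 := LinearPMap.sup_apply H ⟨x, hx⟩ 0 ⟨x, Submodule.mem_sup_left hx⟩ (by simp)
    have h2 := LinearMap.congr_fun hh ⟨x, Submodule.mem_sup_left hx⟩
    rw [LinearPMap.map_zero, add_zero] at h1
    exact h2.trans h1
  · have h1 := LinearPMap.sup_apply H 0 ⟨x, hx⟩ ⟨x, Submodule.mem_sup_right hx⟩ (by simp)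
    have h2 := LinearMap.congr_fun hh ⟨x, Submodule.mem_sup_right hx⟩
    rw [LinearPMap.map_zero, zero_add] at h1
    exact h2.trans h1

theorem Submodule.map_eq_map_of_forall_eq {P : Submodule F V} {f g : V →ₗ[F] V'}
    (h : ∀ x ∈ P, f x = g x) : P.map f = P.map g :=
  SetLike.coe_injective (Set.image_congr h)

theorem Submodule.finrank_map_of_forall_eq_zero (P : Submodule F V) (h : V →ₗ[F] V')
    (hinj : ∀ x ∈ P, h x = 0 → x = 0) : finrank F (P.map h) = finrank F P := by
  rw [← LinearMap.range_domRestrict]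
  refine LinearMap.finrank_range_of_inj ?_
  rw [← LinearMap.ker_eq_bot, LinearMap.ker_eq_bot']
  rintro ⟨x, hx⟩ h0
  exact Subtype.ext (hinj x hx h0)

theorem Submodule.finrank_map_add_finrank_inf_ker [FiniteDimensional F V]
    (T : Submodule F V) (q : V →ₗ[F] Y) :
    finrank F (T.map q) + finrank F ↥(T ⊓ LinearMap.ker q) = finrank F T := by
  have h := LinearMap.finrank_range_add_finrank_ker (q.domRestrict T)
  rw [LinearMap.range_domRestrict] at h
  rw [← h, LinearMap.ker_domRestrict]
  congr 1
  rw [← Submodule.map_comap_subtype]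
  exact (Submodule.finrank_map_of_forall_eq_zero _ _ fun x _ hx => Subtype.ext hx)

theorem LinearMap.exists_eqOn_apply_eq (P : Submodule F V) (h : V →ₗ[F] V')
    (hinj : ∀ x ∈ P, h x = 0 → x = 0) (z : V) (hz : z ∉ P) (z' : V') (hz' : z' ∉ P.map h) :
    ∃ h₂ : V →ₗ[F] V', (∀ x ∈ P, h₂ x = h x) ∧ h₂ z = z' ∧
      ∀ x ∈ P ⊔ Submodule.span F {z}, h₂ x = 0 → x = 0 := by
  obtain ⟨h₂, h₂P, e⟩ := LinearMap.exists_extend_of_notMem (h.domRestrict P) hz z'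
  replace h₂P : ∀ x ∈ P, h₂ x = h x := fun x hx => LinearMap.congr_fun h₂P ⟨x, hx⟩
  refine ⟨h₂, h₂P, e, fun x hx hx0 => ?_⟩
  obtain ⟨w, hw, y, hy, rfl⟩ := Submodule.mem_sup.1 hx
  obtain ⟨c, rfl⟩ := Submodule.mem_span_singleton.1 hy
  rw [map_add, map_smul, e, h₂P w hw] at hx0
  by_cases hc : c = 0
  · subst hc
    simp only [zero_smul, add_zero] at hx0 ⊢
    exact hinj w hw hx0
  · exfalso
    apply hz'
    rw [← Submodule.smul_mem_iff _ hc, ← neg_eq_of_add_eq_zero_right hx0]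
    exact Submodule.neg_mem _ (Submodule.mem_map_of_mem hw)

theorem LinearMap.exists_extend_of_map_eq [FiniteDimensional F V] [FiniteDimensional F V']
    (q : V →ₗ[F] Y) (q' : V' →ₗ[F] Y) (T : Submodule F V) (T' : Submodule F V')
    (hdim : finrank F T = finrank F T') (hq : T.map q = T'.map q') (n : ℕ) :
    ∀ (P : Submodule F V) (h : V →ₗ[F] V'), finrank F T ≤ n + finrank F P → P ≤ T →
      (∀ x ∈ P, h x = 0 → x = 0) → (∀ x ∈ P, h x ∈ T') → (∀ x ∈ P, q' (h x) = q x) →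
      ∃ h₂ : V →ₗ[F] V', (∀ x ∈ P, h₂ x = h x) ∧ (∀ x ∈ T, h₂ x = 0 → x = 0) ∧
        T.map h₂ = T' ∧ ∀ x ∈ T, q' (h₂ x) = q x := by
  induction n with
  | zero =>
    intro P h hn hWT hinj hT' hqq
    obtain rfl : P = T := Submodule.eq_of_le_of_finrank_le hWT (by simpa using hn)
    refine ⟨h, fun _ _ => rfl, hinj, ?_, hqq⟩
    refine Submodule.eq_of_le_of_finrank_eq ?_ ?_
    · rintro _ ⟨x, hx, rfl⟩
      exact hT' x hx
    · rw [Submodule.finrank_map_of_forall_eq_zero _ _ hinj, hdim]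
  | succ n ih =>
    intro P h hn hWT hinj hT' hqq
    by_cases hW : P = T
    · refine ih P h ?_ hWT hinj hT' hqq
      rw [hW]
      omega
    suffices H : ∃ z ∈ T, z ∉ P ∧ ∃ z' ∈ T', z' ∉ P.map h ∧ q' z' = q z by
      obtain ⟨z, hzT, hzW, z', hzT', hzW', hzq⟩ := H
      obtain ⟨h₁, h₁P, h₁z, h₁inj⟩ := LinearMap.exists_eqOn_apply_eq P h hinj z hzW z' hzW'
      have key : ∀ x ∈ P ⊔ Submodule.span F {z}, h₁ x ∈ T' ∧ q' (h₁ x) = q x := by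
        intro x hx
        obtain ⟨w, hw, y, hy, rfl⟩ := Submodule.mem_sup.1 hx
        obtain ⟨c, rfl⟩ := Submodule.mem_span_singleton.1 hy
        simp only [map_add, map_smul, h₁P w hw, h₁z, hqq w hw, hzq, and_true]
        exact T'.add_mem (hT' w hw) (T'.smul_mem c hzT')
      have hlt : P < P ⊔ Submodule.span F {z} := by
        refine lt_of_le_of_ne le_sup_left fun he => hzW ?_
        rw [he]
        exact Submodule.mem_sup_right (Submodule.mem_span_singleton_self z)
      have hlt' := Submodule.finrank_lt_finrank_of_lt hlt
      obtain ⟨h₂, h₂P, hh₂⟩ := ih (P ⊔ Submodule.span F {z}) h₁ (by omega)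
        (sup_le hWT (by simpa using hzT)) h₁inj (fun x hx => (key x hx).1) fun x hx => (key x hx).2
      exact ⟨h₂, fun x hx => (h₂P x (Submodule.mem_sup_left hx)).trans (h₁P x hx), hh₂⟩
    by_cases hK : T ⊓ LinearMap.ker q ≤ P
    · obtain ⟨z, hzT, hzW⟩ := SetLike.exists_of_lt (lt_of_le_of_ne hWT hW)
      obtain ⟨z', hzT', hz'⟩ : q z ∈ T'.map q' := hq ▸ Submodule.mem_map_of_mem hzT
      refine ⟨z, hzT, hzW, z', hzT', ?_, hz'⟩
      rintro ⟨w, hw, rfl⟩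
      apply hzW
      have : z - w ∈ P := hK ⟨T.sub_mem hzT (hWT hw), LinearMap.mem_ker.2 (by
        rw [map_sub, ← hz', hqq w hw, sub_self])⟩
      simpa using P.add_mem this hw
    · obtain ⟨z, ⟨hzT, hzq⟩, hzW⟩ := Set.not_subset.1 hK
      have hnle : ¬ T' ⊓ LinearMap.ker q' ≤ (P ⊓ LinearMap.ker q).map h := by
        intro hle
        have h1 := Submodule.finrank_mono hle
        rw [Submodule.finrank_map_of_forall_eq_zero (P ⊓ LinearMap.ker q) h
          fun x hx => hinj x hx.1] at h1
        have h2 := Submodule.finrank_map_add_finrank_inf_ker T q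
        have h3 := Submodule.finrank_map_add_finrank_inf_ker T' q'
        rw [hq] at h2
        have h4 : P ⊓ LinearMap.ker q < T ⊓ LinearMap.ker q := by
          refine lt_of_le_of_ne (inf_le_inf_right _ hWT) fun he => hzW ?_
          have : z ∈ T ⊓ LinearMap.ker q := ⟨hzT, hzq⟩
          rw [← he] at this
          exact this.1
        have h5 := Submodule.finrank_lt_finrank_of_lt h4
        omega
      obtain ⟨z', ⟨hzT', hzq'⟩, hz'⟩ := Set.not_subset.1 hnle
      have hzq : q z = 0 := hzq
      have hzq' : q' z' = 0 := hzq'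
      refine ⟨z, hzT, hzW, z', hzT', ?_, hzq'.trans hzq.symm⟩
      rintro ⟨w, hw, rfl⟩
      exact hz' ⟨w, ⟨hw, LinearMap.mem_ker.2 ((hqq w hw).symm.trans hzq')⟩, rfl⟩

theorem LinearMap.exists_extend_flag_step [FiniteDimensional F V] [FiniteDimensional F V']
    (q : V →ₗ[F] Y) (q' : V' →ₗ[F] Y) (S T X : Submodule F V) (S' T' : Submodule F V')
    (hST : S ≤ T) (hST' : S' ≤ T')
    (hdim : finrank F T = finrank F T') (hq : T.map q = T'.map q')
    (f : V →ₗ[F] V') (hfq : ∀ x ∈ X, q' (f x) = q x)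
    (hfS : ∀ x ∈ X, x ∈ S ↔ f x ∈ S') (hfT : ∀ x ∈ X, x ∈ T → f x ∈ T')
    (h : V →ₗ[F] V') (h0 : ∀ x ∈ S, h x = 0 → x = 0) (hS : S.map h = S')
    (hhq : ∀ x ∈ S, q' (h x) = q x) (hhf : ∀ x ∈ X, x ∈ S → h x = f x) :
    ∃ h₂ : V →ₗ[F] V', (∀ x ∈ S, h₂ x = h x) ∧ (∀ x ∈ X, x ∈ T → h₂ x = f x) ∧
      (∀ x ∈ T, h₂ x = 0 → x = 0) ∧ T.map h₂ = T' ∧ ∀ x ∈ T, q' (h₂ x) = q x := by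
  have hS' : ∀ x ∈ S, h x ∈ S' := fun x hx => hS ▸ Submodule.mem_map_of_mem hx
  obtain ⟨h₁, h₁S, h₁X⟩ := LinearMap.exists_eqOn_eqOn S (X ⊓ T) h f
    fun x hxS hxX => hhf x hxX.1 hxS
  obtain ⟨h₂, h₂P, h₂0, h₂T, h₂q⟩ := LinearMap.exists_extend_of_map_eq q q' T T' hdim hq
    (finrank F T) (S ⊔ X ⊓ T) h₁ (by omega) (sup_le hST inf_le_right)
    (by
      intro z hz hz0
      obtain ⟨u, hu, x, hx, rfl⟩ := Submodule.mem_sup.1 hz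
      rw [map_add, h₁S u hu, h₁X x hx] at hz0
      have hxS : x ∈ S := by
        rw [hfS x hx.1, ← neg_eq_of_add_eq_zero_right hz0]
        exact S'.neg_mem (hS' u hu)
      refine h0 _ (S.add_mem hu hxS) ?_
      rw [map_add, hhf x hx.1 hxS, hz0])
    (by
      intro z hz
      obtain ⟨u, hu, x, hx, rfl⟩ := Submodule.mem_sup.1 hz
      rw [map_add, h₁S u hu, h₁X x hx]
      exact T'.add_mem (hST' (hS' u hu)) (hfT x hx.1 hx.2))
    (by
      intro z hz
      obtain ⟨u, hu, x, hx, rfl⟩ := Submodule.mem_sup.1 hz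
      rw [map_add, h₁S u hu, h₁X x hx, map_add, map_add, hhq u hu, hfq x hx.1])
  exact ⟨h₂, fun x hx => (h₂P x (Submodule.mem_sup_left hx)).trans (h₁S x hx),
    fun x hx hxT => (h₂P x (Submodule.mem_sup_right ⟨hx, hxT⟩)).trans (h₁X x ⟨hx, hxT⟩),
    h₂0, h₂T, h₂q⟩

end LinearAlgebra

namespace Witt

variable {F V V' : Type*} [Field F] [AddCommGroup V] [Module F V]
  [AddCommGroup V'] [Module F V']

theorem IsIsometry.trans {V₁ V₂ V₃ : Type*} [AddCommGroup V₁] [Module F V₁]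
    [AddCommGroup V₂] [Module F V₂] [AddCommGroup V₃] [Module F V₃]
    {B₁ : LinearMap.BilinForm F V₁} {B₂ : LinearMap.BilinForm F V₂}
    {B₃ : LinearMap.BilinForm F V₃} {σ : V₁ ≃ₗ[F] V₂} {τ : V₂ ≃ₗ[F] V₃}
    (hσ : IsIsometry B₁ B₂ σ) (hτ : IsIsometry B₂ B₃ τ) : IsIsometry B₁ B₃ (σ.trans τ) :=
  fun u v => (hτ _ _).trans (hσ u v)

theorem exists_isometry_reflection {B : LinearMap.BilinForm F V} (hB : ∀ u v, B u v = B v u)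
    {u : V} (hu : B u u ≠ 0) :
    ∃ τ : V ≃ₗ[F] V, IsIsometry B B τ ∧ ∀ x, τ x = x - (2 * B u x / B u u) • u := by
  have hf : ((2 / B u u) • B u) u = 2 := by simp [hu]
  have h : ∀ x, Module.reflection hf x = x - (2 * B u x / B u u) • u := by
    intro x
    rw [Module.reflection_apply, LinearMap.smul_apply, smul_eq_mul, div_mul_eq_mul_div]
  refine ⟨Module.reflection hf, fun x y => ?_, h⟩
  simp only [h, map_sub, map_smul, LinearMap.sub_apply, LinearMap.smul_apply, smul_eq_mul, hB x u]
  field_simp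
  ring

theorem exists_isometry_apply_eq (hchar : (2 : F) ≠ 0) {B : LinearMap.BilinForm F V}
    (hB : ∀ u v, B u v = B v u) {a b : V} (ha : B a a ≠ 0) (hab : B a a = B b b) :
    ∃ τ : V ≃ₗ[F] V, IsIsometry B B τ ∧ τ a = b ∧
      ∀ w, B a w = 0 → B b w = 0 → τ w = w := by
  by_cases hs : B (a - b) (a - b) = 0
  · have hs' : B (a + b) (a + b) ≠ 0 := by
      intro h
      apply mul_ne_zero (mul_ne_zero hchar hchar) ha
      simp only [map_add, map_sub, LinearMap.add_apply, LinearMap.sub_apply, hB b a] at h hs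
      linear_combination h + hs + 2 * hab
    have hb : B b b ≠ 0 := hab ▸ ha
    obtain ⟨τ, hτ, e⟩ := exists_isometry_reflection hB hs'
    obtain ⟨ρ, hρ, e'⟩ := exists_isometry_reflection hB hb
    refine ⟨τ.trans ρ, hτ.trans hρ, ?_, fun w hw hw' => ?_⟩
    · have h1 : 2 * B (a + b) a / B (a + b) (a + b) = 1 := by
        rw [div_eq_one_iff_eq hs']
        simp only [map_add, LinearMap.add_apply, hB b a]
        linear_combination hab
      have h2 : 2 * B b (-b) / B b b = -2 := by
        rw [map_neg]
        field_simp
      rw [LinearEquiv.trans_apply, e, h1, one_smul, sub_add_cancel_left, e', h2]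
      module
    · rw [LinearEquiv.trans_apply, e, map_add, LinearMap.add_apply, hw, hw']
      simp [e', hw']
  · obtain ⟨τ, hτ, e⟩ := exists_isometry_reflection hB hs
    refine ⟨τ, hτ, ?_, fun w hw hw' => ?_⟩
    · have h1 : 2 * B (a - b) a / B (a - b) (a - b) = 1 := by
        rw [div_eq_one_iff_eq hs]
        simp only [map_sub, LinearMap.sub_apply, hB b a]
        linear_combination hab
      rw [e, h1, one_smul, sub_sub_cancel]
    · rw [e, map_sub, LinearMap.sub_apply, hw, hw']
      simp

theorem exists_isometry_of_orthogonal_family (hchar : (2 : F) ≠ 0)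
    {B : LinearMap.BilinForm F V} {B' : LinearMap.BilinForm F V'}
    (hB' : ∀ u v, B' u v = B' v u) (hVV' : AreIsometric B B') {ι : Type*} (s : Finset ι)
    (v : ι → V) (v' : ι → V') (hv : ∀ i, B (v i) (v i) ≠ 0)
    (hort : ∀ i j, i ≠ j → B (v i) (v j) = 0)
    (hvv' : ∀ i j, B' (v' i) (v' j) = B (v i) (v j)) :
    ∃ ρ : V ≃ₗ[F] V', IsIsometry B B' ρ ∧ ∀ i ∈ s, ρ (v i) = v' i := by
  classical
  induction s using Finset.induction_on with
  | empty =>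
    obtain ⟨ρ, hρ⟩ := hVV'
    exact ⟨ρ, hρ, by simp⟩
  | insert j s hj ih =>
    obtain ⟨ρ, hρ, hρv⟩ := ih
    obtain ⟨τ, hτ, hτj, hτw⟩ := exists_isometry_apply_eq hchar hB' (a := ρ (v j)) (b := v' j)
      (by rw [hρ]; exact hv j) (by rw [hρ, hvv'])
    refine ⟨ρ.trans τ, hρ.trans hτ, fun i hi => ?_⟩
    rw [LinearEquiv.trans_apply]
    rcases Finset.mem_insert.1 hi with rfl | hi
    · exact hτj
    · have hji : j ≠ i := fun h => hj (h ▸ hi)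
      rw [hρv i hi]
      refine hτw _ ?_ ?_
      · rw [← hρv i hi, hρ, hort j i hji]
      · rw [hvv', hort j i hji]

/-- The Witt extension theorem for nonsingular subspaces. -/
theorem exists_isometry_extend (hchar : (2 : F) ≠ 0) [FiniteDimensional F V]
    {B : LinearMap.BilinForm F V} {B' : LinearMap.BilinForm F V'}
    (hB : ∀ u v, B u v = B v u) (hB' : ∀ u v, B' u v = B' v u) (hVV' : AreIsometric B B')
    (P : Submodule F V) (hW : ∀ u ∈ P, (∀ w ∈ P, B u w = 0) → u = 0)
    (σ : V →ₗ[F] V') (hσ : ∀ u ∈ P, ∀ w ∈ P, B' (σ u) (σ w) = B u w) :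
    ∃ ρ : V ≃ₗ[F] V', IsIsometry B B' ρ ∧ ∀ w ∈ P, ρ w = σ w := by
  have : Invertible (2 : F) := invertibleOfNonzero hchar
  obtain ⟨b, hb⟩ := LinearMap.BilinForm.exists_orthogonal_basis (B := B.restrict P)
    ⟨fun u v => hB u v⟩
  have hsep : (B.restrict P).SeparatingLeft := fun u hu =>
    Subtype.ext (hW u u.2 fun w hw => hu ⟨w, hw⟩)
  have hbb := hb.not_isOrtho_basis_self_of_separatingLeft hsep
  obtain ⟨ρ, hρ, hρb⟩ := exists_isometry_of_orthogonal_family hchar hB' hVV' Finset.univ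
    (fun i => (b i : V)) (fun i => σ (b i)) hbb (fun i j hij => hb hij)
    fun i j => hσ _ (b i).2 _ (b j).2
  refine ⟨ρ, hρ, fun w hw => ?_⟩
  have : ρ.toLinearMap ∘ₗ P.subtype = σ ∘ₗ P.subtype :=
    b.ext fun i => hρb i (Finset.mem_univ i)
  exact LinearMap.congr_fun this ⟨w, hw⟩

end Witt

section Pproj3

variable {F V : Type*} [Field F] [AddCommGroup V] [Module F V]
  {A C D E : Submodule F V} {v a c d : V}

theorem mem_Pproj3_of_mem (hv : v ∈ E) (ha : a ∈ A) (hc : c ∈ C) (hd : d ∈ D)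
    (h : v = a + c + d) :
    a ∈ (E ⊔ C ⊔ D) ⊓ A ∧ c ∈ (E ⊔ D ⊔ A) ⊓ C ∧ d ∈ (E ⊔ A ⊔ C) ⊓ D := by
  refine ⟨⟨?_, ha⟩, ⟨?_, hc⟩, ⟨?_, hd⟩⟩
  · rw [show a = v + -c + -d by rw [h]; abel]
    exact Submodule.add_mem_sup (Submodule.add_mem_sup hv (C.neg_mem hc)) (D.neg_mem hd)
  · rw [show c = v + -d + -a by rw [h]; abel]
    exact Submodule.add_mem_sup (Submodule.add_mem_sup hv (D.neg_mem hd)) (A.neg_mem ha)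
  · rw [show d = v + -a + -c by rw [h]; abel]
    exact Submodule.add_mem_sup (Submodule.add_mem_sup hv (A.neg_mem ha)) (C.neg_mem hc)

theorem exists_of_mem_sup_sup (h : a ∈ E ⊔ C ⊔ D) :
    ∃ c ∈ C, ∃ d ∈ D, a + c + d ∈ E := by
  obtain ⟨y, hy, d, hd, rfl⟩ := Submodule.mem_sup.1 h
  obtain ⟨e, he, c, hc, rfl⟩ := Submodule.mem_sup.1 hy
  refine ⟨-c, C.neg_mem hc, -d, D.neg_mem hd, ?_⟩
  rwa [show e + c + d + -c + -d = e by abel]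

theorem Pproj3_map {V' : Type*} [AddCommGroup V'] [Module F V'] (f : V →ₗ[F] V')
    (hf : Function.Injective f) (A C D E : Submodule F V) :
    (Pproj3 A C D E).map f = Pproj3 (A.map f) (C.map f) (D.map f) (E.map f) := by
  simp only [Pproj3, Submodule.map_sup, Submodule.map_inf f hf]

end Pproj3

namespace IsWittDecomposition

variable {F V V' : Type*} [Field F] [AddCommGroup V] [Module F V]
  [AddCommGroup V'] [Module F V']
  {B : LinearMap.BilinForm F V} {Vp Vh Vm : Submodule F V}
  {B' : LinearMap.BilinForm F V'} {Vp' Vh' Vm' : Submodule F V'}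

theorem swap (h : IsWittDecomposition B Vp Vh Vm) : IsWittDecomposition B Vm Vh Vp where
  totIso_p := h.totIso_m
  totIso_m := h.totIso_p
  max_p := h.max_m
  max_m := h.max_p
  dim_eq := h.dim_eq.symm
  aniso := h.aniso
  orth_p := h.orth_m
  orth_m := h.orth_p
  disj_p := by rw [sup_comm Vh, h.disj_m]
  disj_h := by rw [sup_comm Vm, h.disj_h]
  disj_m := by rw [sup_comm Vm, h.disj_p]
  sup_eq := by rw [← h.sup_eq, sup_right_comm, sup_comm Vm, sup_right_comm]

theorem exists_eq_add (h : IsWittDecomposition B Vp Vh Vm) (v : V) :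
    ∃ a ∈ Vp, ∃ b ∈ Vh, ∃ c ∈ Vm, v = a + b + c := by
  have hv : v ∈ Vp ⊔ Vh ⊔ Vm := h.sup_eq ▸ Submodule.mem_top
  obtain ⟨y, hy, c, hc, rfl⟩ := Submodule.mem_sup.1 hv
  obtain ⟨a, ha, b, hb, rfl⟩ := Submodule.mem_sup.1 hy
  exact ⟨a, ha, b, hb, c, hc, rfl⟩

theorem eq_zero_of_add_eq_zero (h : IsWittDecomposition B Vp Vh Vm) {a b c : V}
    (ha : a ∈ Vp) (hb : b ∈ Vh) (hc : c ∈ Vm) (h0 : a + b + c = 0) : a = 0 ∧ b = 0 ∧ c = 0 := by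
  have ha0 : a = 0 := by
    rw [← Submodule.mem_bot F, ← h.disj_p]
    refine ⟨ha, ?_⟩
    rw [show a = -b + -c by rw [← sub_eq_zero, ← h0]; abel]
    exact Submodule.add_mem_sup (Vh.neg_mem hb) (Vm.neg_mem hc)
  have hb0 : b = 0 := by
    rw [← Submodule.mem_bot F, ← h.disj_h]
    refine ⟨hb, ?_⟩
    rw [show b = -a + -c by rw [← sub_eq_zero, ← h0]; abel]
    exact Submodule.add_mem_sup (Vp.neg_mem ha) (Vm.neg_mem hc)
  subst ha0 hb0
  simpa using h0

theorem add_inj (h : IsWittDecomposition B Vp Vh Vm) {a b c a₁ b₁ c₁ : V}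
    (ha : a ∈ Vp) (hb : b ∈ Vh) (hc : c ∈ Vm) (ha₁ : a₁ ∈ Vp) (hb₁ : b₁ ∈ Vh) (hc₁ : c₁ ∈ Vm)
    (he : a + b + c = a₁ + b₁ + c₁) : a = a₁ ∧ b = b₁ ∧ c = c₁ := by
  obtain ⟨h1, h2, h3⟩ := h.eq_zero_of_add_eq_zero (Vp.sub_mem ha ha₁) (Vh.sub_mem hb hb₁)
    (Vm.sub_mem hc hc₁) (by rw [← sub_eq_zero.2 he]; abel)
  exact ⟨sub_eq_zero.1 h1, sub_eq_zero.1 h2, sub_eq_zero.1 h3⟩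

theorem eq_zero_of_forall (h : IsWittDecomposition B Vp Vh Vm) (hB : ∀ u v, B u v = B v u)
    (hnd : B.Nondegenerate) {a : V} (ha : a ∈ Vp) (h0 : ∀ c ∈ Vm, B a c = 0) : a = 0 := by
  refine hnd.1 a fun v => ?_
  obtain ⟨x, hx, y, hy, z, hz, rfl⟩ := h.exists_eq_add v
  rw [map_add, map_add, h.totIso_p a ha x hx, hB a y, h.orth_p y hy a ha, h0 z hz]
  simp

theorem mem_of_forall (h : IsWittDecomposition B Vp Vh Vm) (hB : ∀ u v, B u v = B v u)
    (hnd : B.Nondegenerate) {v : V} (hp : ∀ u ∈ Vp, B v u = 0) (hm : ∀ u ∈ Vm, B v u = 0) :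
    v ∈ Vh := by
  obtain ⟨a, ha, b, hb, c, hc, rfl⟩ := h.exists_eq_add v
  have ha0 : a = 0 := by
    refine h.eq_zero_of_forall hB hnd ha fun u hu => ?_
    simpa [h.orth_m b hb u hu, h.totIso_m c hc u hu] using hm u hu
  have hc0 : c = 0 := by
    refine h.swap.eq_zero_of_forall hB hnd hc fun u hu => ?_
    simpa [h.orth_p b hb u hu, h.totIso_p a ha u hu] using hp u hu
  simpa [ha0, hc0] using hb

theorem mem_of_isotropic (h : IsWittDecomposition B Vp Vh Vm) (hB : ∀ u v, B u v = B v u)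
    (hnd : B.Nondegenerate) {v : V} (hp : ∀ u ∈ Vp, B u v = 0) (hv : B v v = 0) : v ∈ Vp := by
  obtain ⟨a, ha, b, hb, c, hc, rfl⟩ := h.exists_eq_add v
  have hc0 : c = 0 := by
    refine h.swap.eq_zero_of_forall hB hnd hc fun u hu => ?_
    have := hp u hu
    simpa [hB u b, h.orth_p b hb u hu, h.totIso_p u hu a ha, hB u c] using this
  subst hc0
  have hb0 : b = 0 := by
    by_contra hb0
    apply h.aniso b hb hb0
    simpa [hB a b, h.orth_p b hb a ha, h.totIso_p a ha a ha] using hv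
  simpa [hb0] using ha

theorem finrank_le_of_totIsotropic [FiniteDimensional F V] (h : IsWittDecomposition B Vp Vh Vm)
    (hB : ∀ u v, B u v = B v u) (hnd : B.Nondegenerate) {N : Submodule F V}
    (hN : TotIsotropic B N) : finrank F N ≤ finrank F Vp := by
  have h1 := LinearMap.BilinForm.finrank_orthogonal hnd Vp
  have h2 := LinearMap.BilinForm.finrank_orthogonal hnd (N ⊓ Vp)
  have h3 := Submodule.finrank_sup_add_finrank_inf_eq N (B.orthogonal Vp)
  have h4 : finrank F ↥(N ⊓ B.orthogonal Vp) ≤ finrank F ↥(N ⊓ Vp) :=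
    Submodule.finrank_mono fun v hv =>
      ⟨hv.1, h.mem_of_isotropic hB hnd hv.2 (hN v hv.1 v hv.1)⟩
  have h5 : finrank F ↥(N ⊔ B.orthogonal Vp) ≤ finrank F (B.orthogonal (N ⊓ Vp)) :=
    Submodule.finrank_mono (sup_le (fun v hv u hu => hN u hu.1 v hv)
      (LinearMap.BilinForm.orthogonal_le inf_le_right))
  have h6 := Submodule.finrank_le Vp
  have h7 := Submodule.finrank_le (N ⊓ Vp)
  omega

theorem finrank_le_of_areIsometric [FiniteDimensional F V'] (h : IsWittDecomposition B Vp Vh Vm)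
    (h' : IsWittDecomposition B' Vp' Vh' Vm') (hB' : ∀ u v, B' u v = B' v u)
    (hnd' : B'.Nondegenerate) (hVV' : AreIsometric B B') : finrank F Vp ≤ finrank F Vp' := by
  obtain ⟨ρ, hρ⟩ := hVV'
  rw [← LinearEquiv.finrank_map_eq ρ Vp]
  refine h'.finrank_le_of_totIsotropic hB' hnd' ?_
  rintro _ ⟨u, hu, rfl⟩ _ ⟨v, hv, rfl⟩
  exact (hρ u v).trans (h.totIso_p u hu v hv)

theorem exists_dual_map [FiniteDimensional F V'] [FiniteDimensional F V]
    (h' : IsWittDecomposition B' Vp' Vh' Vm') (hB' : ∀ u v, B' u v = B' v u)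
    (hnd' : B'.Nondegenerate) (hdim : finrank F Vp = finrank F Vp') (f : V →ₗ[F] V')
    (hf : Vp.map f = Vp') :
    ∃ g : V →ₗ[F] V', ∀ c, g c ∈ Vm' ∧ ∀ u ∈ Vp, B' (f u) (g c) = B u c := by
  let L : Vm' →ₗ[F] Dual F Vp := (B' ∘ₗ f ∘ₗ Vp.subtype).flip ∘ₗ Vm'.subtype
  let R : V →ₗ[F] Dual F Vp := (B ∘ₗ Vp.subtype).flip
  have hL : Function.Injective L := by
    rw [← LinearMap.ker_eq_bot, LinearMap.ker_eq_bot']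
    rintro ⟨c, hc⟩ h0
    refine Subtype.ext (h'.swap.eq_zero_of_forall hB' hnd' hc fun u hu => ?_)
    rw [← hf] at hu
    obtain ⟨u, hu, rfl⟩ := hu
    rw [hB']
    exact LinearMap.congr_fun h0 ⟨u, hu⟩
  let L' := LinearMap.linearEquivOfInjective L hL
    (by rw [Subspace.dual_finrank_eq, hdim, h'.dim_eq])
  refine ⟨Vm'.subtype ∘ₗ L'.symm.toLinearMap ∘ₗ R, fun c => ⟨(L'.symm (R c)).2, fun u hu => ?_⟩⟩
  have : L (L'.symm (R c)) = R c := L'.apply_symm_apply (R c)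
  exact LinearMap.congr_fun this ⟨u, hu⟩

end IsWittDecomposition

theorem map_eq_map_of_forall_pairing {F V V' : Type*} [Field F] [AddCommGroup V] [Module F V]
    [AddCommGroup V'] [Module F V'] [FiniteDimensional F V]
    (B : LinearMap.BilinForm F V) (B' : LinearMap.BilinForm F V') (D : Submodule F V)
    (f : V →ₗ[F] V') (T : Submodule F V) (T' : Submodule F V')
    (h : ∀ d ∈ D, (∀ u ∈ T, B u d = 0) ↔ ∀ u ∈ T', B' u (f d) = 0) :
    T.map (B.flip ∘ₗ D.subtype).flip = T'.map (B'.flip ∘ₗ f ∘ₗ D.subtype).flip := by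
  have key : ∀ S S' : Subspace F (Dual F D),
      S.dualCoannihilator = S'.dualCoannihilator → S = S' := fun S S' e => by
    rw [← S.dualCoannihilator_dualAnnihilator_eq, e, S'.dualCoannihilator_dualAnnihilator_eq]
  refine key _ _ ?_
  ext d
  simpa [Submodule.mem_dualCoannihilator] using h d d.2

theorem le_of_le_of_forall_le_succ {α : Type*} [Preorder α] {k : ℕ} {s : ℕ → α}
    (hs : ∀ i < k, s i ≤ s (i + 1)) {i j : ℕ} (hij : i ≤ j) (hj : j ≤ k) : s i ≤ s j := by
  induction j, hij using Nat.le_induction with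
  | base => exact le_rfl
  | succ j _ ih => exact (ih (by omega)).trans (hs j (by omega))

theorem IsWittDecomposition.exists_extend_flag {F V V' : Type*} [Field F]
    [AddCommGroup V] [Module F V] [AddCommGroup V'] [Module F V']
    [FiniteDimensional F V] [FiniteDimensional F V']
    {B : LinearMap.BilinForm F V} {B' : LinearMap.BilinForm F V'}
    (hB : ∀ u v : V, B u v = B v u) (hB' : ∀ u v : V', B' u v = B' v u)
    (hnd : B.Nondegenerate) (hnd' : B'.Nondegenerate)
    {Vp Vh Vm : Submodule F V} {Vp' Vh' Vm' : Submodule F V'}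
    (hWitt : IsWittDecomposition B Vp Vh Vm) (hWitt' : IsWittDecomposition B' Vp' Vh' Vm')
    (hdim : finrank F Vp = finrank F Vp')
    {k : ℕ} {𝒱 : ℕ → Submodule F V} {𝒱' : ℕ → Submodule F V'}
    (h0 : 𝒱 0 = ⊥) (hmono : ∀ i < k, 𝒱 i ≤ 𝒱 (i + 1))
    (h0' : 𝒱' 0 = ⊥) (hmono' : ∀ i < k, 𝒱' i ≤ 𝒱' (i + 1))
    (hsd : ∀ i ≤ k, B.orthogonal (𝒱 i) = 𝒱 (k - i))
    (hsd' : ∀ i ≤ k, B'.orthogonal (𝒱' i) = 𝒱' (k - i))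
    (hflagdim : ∀ i ≤ k, finrank F (𝒱 i) = finrank F (𝒱' i))
    (hcomp : 𝒱 (k / 2) ≤ Vp) (hcomp' : 𝒱' (k / 2) ≤ Vp')
    {X D : Submodule F V} (hX : X ≤ Vp) (hD : D ≤ Vm) (f : V →ₗ[F] V')
    (hfX : ∀ x ∈ X, f x ∈ Vp') (hfD : ∀ d ∈ D, f d ∈ Vm')
    (hf : ∀ x ∈ X, ∀ d ∈ D, B' (f x) (f d) = B x d)
    (hX𝒱 : ∀ x ∈ X, ∀ i ≤ k, x ∈ 𝒱 i ↔ f x ∈ 𝒱' i)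
    (hD𝒱 : ∀ x ∈ D, ∀ i ≤ k, x ∈ 𝒱 i ↔ f x ∈ 𝒱' i) :
    ∃ h : V →ₗ[F] V', (∀ x ∈ X, h x = f x) ∧ (∀ x ∈ Vp, h x = 0 → x = 0) ∧ Vp.map h = Vp' ∧
      (∀ i ≤ k / 2, (𝒱 i).map h = 𝒱' i) ∧ ∀ u ∈ Vp, ∀ d ∈ D, B' (h u) (f d) = B u d := by
  set q := (B.flip ∘ₗ D.subtype).flip
  set q' := (B'.flip ∘ₗ f ∘ₗ D.subtype).flip
  have hqq : ∀ (h : V →ₗ[F] V') (x : V),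
      q' (h x) = q x ↔ ∀ d ∈ D, B' (h x) (f d) = B x d := fun h x =>
    ⟨fun e d hd => LinearMap.congr_fun e ⟨d, hd⟩, fun e => LinearMap.ext fun d => e d d.2⟩
  have hfq : ∀ x ∈ X, q' (f x) = q x := fun x hx => (hqq f x).2 (hf x hx)
  have hmap : ∀ i ≤ k, (𝒱 i).map q = (𝒱' i).map q' := fun i hi =>
    map_eq_map_of_forall_pairing B B' D f _ _ fun d hd => by
      have := hD𝒱 d hd (k - i) (by omega)
      rwa [← hsd i hi, ← hsd' i hi] at this
  have hfd : ∀ d ∈ D, f d = 0 → d = 0 := fun d hd e => by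
    have := (hD𝒱 d hd 0 (by omega)).2 (by rw [e]; exact Submodule.zero_mem _)
    simpa [h0] using this
  have hmapp : Vp.map q = Vp'.map q' := map_eq_map_of_forall_pairing B B' D f _ _ fun d hd => by
    constructor
    · intro hd0
      rw [hWitt.swap.eq_zero_of_forall hB hnd (hD hd) fun u hu => (hB d u).trans (hd0 u hu)]
      simp
    · intro hd0
      rw [hfd d hd (hWitt'.swap.eq_zero_of_forall hB' hnd' (hfD d hd)
        fun u hu => (hB' (f d) u).trans (hd0 u hu))]
      simp
  have ind : ∀ j ≤ k / 2, ∃ h : V →ₗ[F] V', (∀ x ∈ X, x ∈ 𝒱 j → h x = f x) ∧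
      (∀ x ∈ 𝒱 j, h x = 0 → x = 0) ∧ (∀ i ≤ j, (𝒱 i).map h = 𝒱' i) ∧
      ∀ x ∈ 𝒱 j, q' (h x) = q x := by
    intro j
    induction j with
    | zero =>
      intro _
      refine ⟨0, ?_, ?_, ?_, ?_⟩ <;> simp +contextual [h0, h0']
    | succ j ih =>
      intro hj
      obtain ⟨h, hX, hinj, hi, hh⟩ := ih (by omega)
      obtain ⟨h₂, h₂S, h₂X, h₂0, h₂T, h₂q⟩ := LinearMap.exists_extend_flag_step q q' (𝒱 j)
        (𝒱 (j + 1)) X (𝒱' j) (𝒱' (j + 1)) (hmono j (by omega)) (hmono' j (by omega))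
        (hflagdim _ (by omega)) (hmap _ (by omega)) f hfq
        (fun x hx => hX𝒱 x hx j (by omega)) (fun x hx => (hX𝒱 x hx (j + 1) (by omega)).1)
        h hinj (hi j le_rfl) hh hX
      refine ⟨h₂, h₂X, h₂0, fun i hij => ?_, h₂q⟩
      rcases Nat.le_succ_iff.1 hij with hij | rfl
      · rw [← hi i hij]
        exact Submodule.map_eq_map_of_forall_eq fun x hx =>
          h₂S x (le_of_le_of_forall_le_succ hmono hij (by omega) hx)
      · exact h₂T
  obtain ⟨h, hX', hinj, hi, hh⟩ := ind (k / 2) le_rfl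
  obtain ⟨h₂, h₂S, h₂X, h₂0, h₂T, h₂q⟩ := LinearMap.exists_extend_flag_step q q' (𝒱 (k / 2))
    Vp X (𝒱' (k / 2)) Vp' hcomp hcomp' hdim hmapp f hfq
    (fun x hx => hX𝒱 x hx (k / 2) (by omega)) (fun x hx _ => hfX x hx)
    h hinj (hi _ le_rfl) hh hX'
  refine ⟨h₂, fun x hx => h₂X x hx (hX hx), h₂0, h₂T, fun i hij => ?_,
    fun u hu => (hqq h₂ u).1 (h₂q u hu)⟩
  rw [← hi i hij]
  exact Submodule.map_eq_map_of_forall_eq fun x hx =>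
    h₂S x (le_of_le_of_forall_le_succ hmono hij (by omega) hx)

theorem IsWittDecomposition.exists_isometry_extend {F V V' : Type*} [Field F]
    [AddCommGroup V] [Module F V] [AddCommGroup V'] [Module F V']
    [FiniteDimensional F V] [FiniteDimensional F V']
    (hchar : (2 : F) ≠ 0)
    {B : LinearMap.BilinForm F V} {B' : LinearMap.BilinForm F V'}
    (hB : ∀ u v : V, B u v = B v u) (hB' : ∀ u v : V', B' u v = B' v u)
    (hnd : B.Nondegenerate) (hVV' : AreIsometric B B')
    {Vp Vh Vm : Submodule F V} {Vp' Vh' Vm' : Submodule F V'}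
    (hWitt : IsWittDecomposition B Vp Vh Vm) (hWitt' : IsWittDecomposition B' Vp' Vh' Vm')
    (H : Submodule F V) (hH : H ≤ Vh) (f g t : V →ₗ[F] V')
    (hf : ∀ u ∈ Vp, f u ∈ Vp') (hg : ∀ u ∈ Vm, g u ∈ Vm') (ht : ∀ u ∈ H, t u ∈ Vh')
    (hfg : ∀ u ∈ Vp, ∀ v ∈ Vm, B' (f u) (g v) = B u v)
    (htt : ∀ u ∈ H, ∀ v ∈ H, B' (t u) (t v) = B u v) :
    ∃ ρ : V ≃ₗ[F] V', IsIsometry B B' ρ ∧ (∀ u ∈ Vp, ρ u = f u) ∧ (∀ u ∈ H, ρ u = t u) ∧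
      ∀ u ∈ Vm, ρ u = g u := by
  obtain ⟨σ₁, hσ₁p, hσ₁h⟩ := LinearMap.exists_eqOn_eqOn Vp H f t fun x hx hxH => by
    obtain rfl : x = 0 := by
      rw [← Submodule.mem_bot F, ← hWitt.disj_p]
      exact ⟨hx, Submodule.mem_sup_left (hH hxH)⟩
    simp
  obtain ⟨σ, hσ, hσm⟩ := LinearMap.exists_eqOn_eqOn (Vp ⊔ H) Vm σ₁ g fun x hx hxm => by
    obtain rfl : x = 0 := by
      rw [← Submodule.mem_bot F, ← hWitt.disj_m]
      exact ⟨hxm, sup_le_sup_left hH _ hx⟩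
    simp
  have hσp : ∀ u ∈ Vp, σ u = f u := fun u hu =>
    (hσ u (Submodule.mem_sup_left hu)).trans (hσ₁p u hu)
  have hσh : ∀ u ∈ H, σ u = t u := fun u hu =>
    (hσ u (Submodule.mem_sup_right hu)).trans (hσ₁h u hu)
  have hex : ∀ x ∈ Vp ⊔ H ⊔ Vm, ∃ a ∈ Vp, ∃ b ∈ H, ∃ c ∈ Vm, x = a + b + c := by
    intro x hx
    obtain ⟨y, hy, c, hc, rfl⟩ := Submodule.mem_sup.1 hx
    obtain ⟨a, ha, b, hb, rfl⟩ := Submodule.mem_sup.1 hy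
    exact ⟨a, ha, b, hb, c, hc, rfl⟩
  have hmem : ∀ a ∈ Vp, ∀ b ∈ H, ∀ c ∈ Vm, a + b + c ∈ Vp ⊔ H ⊔ Vm := fun a ha b hb c hc =>
    Submodule.add_mem_sup (Submodule.add_mem_sup ha hb) hc
  have hform : ∀ a ∈ Vp, ∀ b ∈ Vh, ∀ c ∈ Vm, ∀ a₁ ∈ Vp, ∀ b₁ ∈ Vh, ∀ c₁ ∈ Vm,
      B (a + b + c) (a₁ + b₁ + c₁) = B a c₁ + B b b₁ + B a₁ c := by
    intro a ha b hb c hc a₁ ha₁ b₁ hb₁ c₁ hc₁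
    simp only [map_add, LinearMap.add_apply, hWitt.totIso_p a ha a₁ ha₁,
      hWitt.totIso_m c hc c₁ hc₁, hWitt.orth_p b hb a₁ ha₁, hWitt.orth_m b hb c₁ hc₁,
      hB a b₁, hB c b₁, hWitt.orth_p b₁ hb₁ a ha, hWitt.orth_m b₁ hb₁ c hc, hB c a₁]
    ring
  have hform' : ∀ a ∈ Vp', ∀ b ∈ Vh', ∀ c ∈ Vm', ∀ a₁ ∈ Vp', ∀ b₁ ∈ Vh', ∀ c₁ ∈ Vm',
      B' (a + b + c) (a₁ + b₁ + c₁) = B' a c₁ + B' b b₁ + B' a₁ c := by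
    intro a ha b hb c hc a₁ ha₁ b₁ hb₁ c₁ hc₁
    simp only [map_add, LinearMap.add_apply, hWitt'.totIso_p a ha a₁ ha₁,
      hWitt'.totIso_m c hc c₁ hc₁, hWitt'.orth_p b hb a₁ ha₁, hWitt'.orth_m b hb c₁ hc₁,
      hB' a b₁, hB' c b₁, hWitt'.orth_p b₁ hb₁ a ha, hWitt'.orth_m b₁ hb₁ c hc, hB' c a₁]
    ring
  obtain ⟨ρ, hρ, hρσ⟩ := Witt.exists_isometry_extend hchar hB hB' hVV' (Vp ⊔ H ⊔ Vm)
    (by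
      intro x hx hx0
      obtain ⟨a, ha, b, hb, c, hc, rfl⟩ := hex x hx
      have hpair : ∀ a₁ ∈ Vp, ∀ b₁ ∈ H, ∀ c₁ ∈ Vm, B a c₁ + B b b₁ + B a₁ c = 0 :=
        fun a₁ ha₁ b₁ hb₁ c₁ hc₁ => by
          rw [← hform a ha b (hH hb) c hc a₁ ha₁ b₁ (hH hb₁) c₁ hc₁]
          exact hx0 _ (hmem a₁ ha₁ b₁ hb₁ c₁ hc₁)
      have ha0 : a = 0 := hWitt.eq_zero_of_forall hB hnd ha fun u hu => by
        simpa using hpair 0 Vp.zero_mem 0 H.zero_mem u hu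
      have hc0 : c = 0 := hWitt.swap.eq_zero_of_forall hB hnd hc fun u hu => by
        simpa [hB c u] using hpair u hu 0 H.zero_mem 0 Vm.zero_mem
      have hb0 : b = 0 := by
        by_contra hb0
        exact hWitt.aniso b (hH hb) hb0
          (by simpa using hpair 0 Vp.zero_mem b hb 0 Vm.zero_mem)
      simp [ha0, hb0, hc0])
    σ
    (by
      intro x hx y hy
      obtain ⟨a, ha, b, hb, c, hc, rfl⟩ := hex x hx
      obtain ⟨a₁, ha₁, b₁, hb₁, c₁, hc₁, rfl⟩ := hex y hy
      simp only [map_add σ, hσp a ha, hσp a₁ ha₁, hσh b hb, hσh b₁ hb₁, hσm c hc, hσm c₁ hc₁]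
      rw [hform a ha b (hH hb) c hc a₁ ha₁ b₁ (hH hb₁) c₁ hc₁,
        hform' _ (hf a ha) _ (ht b hb) _ (hg c hc) _ (hf a₁ ha₁) _ (ht b₁ hb₁) _ (hg c₁ hc₁),
        hfg a ha c₁ hc₁, hfg a₁ ha₁ c hc, htt b hb b₁ hb₁])
  refine ⟨ρ, hρ, fun u hu => ?_, fun u hu => ?_, fun u hu => ?_⟩
  · rw [hρσ u (Submodule.mem_sup_left (Submodule.mem_sup_left hu)), hσp u hu]
  · rw [hρσ u (Submodule.mem_sup_left (Submodule.mem_sup_right hu)), hσh u hu]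
  · rw [hρσ u (Submodule.mem_sup_right hu), hσm u hu]

theorem IsWittDecomposition.map_eq_of_isometry {F V V' : Type*} [Field F]
    [AddCommGroup V] [Module F V] [AddCommGroup V'] [Module F V']
    {B : LinearMap.BilinForm F V} {B' : LinearMap.BilinForm F V'}
    (hB : ∀ u v : V, B u v = B v u) (hB' : ∀ u v : V', B' u v = B' v u)
    (hnd : B.Nondegenerate) (hnd' : B'.Nondegenerate)
    {Vp Vh Vm : Submodule F V} {Vp' Vh' Vm' : Submodule F V'}
    (hWitt : IsWittDecomposition B Vp Vh Vm) (hWitt' : IsWittDecomposition B' Vp' Vh' Vm')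
    {ρ : V ≃ₗ[F] V'} (hρ : IsIsometry B B' ρ)
    (hp : Vp.map ρ.toLinearMap = Vp') (hm : Vm.map ρ.toLinearMap = Vm') :
    Vh.map ρ.toLinearMap = Vh' := by
  have hp' : ∀ u ∈ Vp, ρ u ∈ Vp' := fun u hu => hp ▸ Submodule.mem_map_of_mem hu
  have hm' : ∀ u ∈ Vm, ρ u ∈ Vm' := fun u hu => hm ▸ Submodule.mem_map_of_mem hu
  apply le_antisymm
  · rintro _ ⟨v, hv, rfl⟩
    refine hWitt'.mem_of_forall hB' hnd' ?_ ?_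
    · rw [← hp]
      rintro _ ⟨u, hu, rfl⟩
      exact (hρ v u).trans (hWitt.orth_p v hv u hu)
    · rw [← hm]
      rintro _ ⟨u, hu, rfl⟩
      exact (hρ v u).trans (hWitt.orth_m v hv u hu)
  · intro v' hv'
    obtain ⟨v, rfl⟩ := ρ.surjective v'
    refine ⟨v, hWitt.mem_of_forall hB hnd (fun u hu => ?_) fun u hu => ?_, rfl⟩
    · rw [← hρ]
      exact hWitt'.orth_p _ hv' _ (hp' u hu)
    · rw [← hρ]
      exact hWitt'.orth_m _ hv' _ (hm' u hu)

theorem Witt.map_orthogonal {F V V' : Type*} [Field F]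
    [AddCommGroup V] [Module F V] [AddCommGroup V'] [Module F V']
    {B : LinearMap.BilinForm F V} {B' : LinearMap.BilinForm F V'}
    {ρ : V ≃ₗ[F] V'} (hρ : IsIsometry B B' ρ) (N : Submodule F V) :
    (B.orthogonal N).map ρ.toLinearMap = B'.orthogonal (N.map ρ.toLinearMap) := by
  ext v'
  obtain ⟨v, rfl⟩ := ρ.surjective v'
  constructor
  · rintro ⟨w, hw, hwv⟩ _ ⟨u, hu, rfl⟩
    obtain rfl := ρ.injective hwv
    exact (hρ u w).trans (hw u hu)
  · intro h
    exact ⟨v, fun u hu => (hρ u v).symm.trans (h (ρ u) (Submodule.mem_map_of_mem hu)), rfl⟩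

/-- Theorem 4.5: extension of an isometry of subspaces preserving given Witt
decompositions and compatible self-dual flags. -/
theorem witt_extension_witt_decomposition_flag {F V V' : Type*} [Field F]
    [AddCommGroup V] [Module F V] [AddCommGroup V'] [Module F V']
    [FiniteDimensional F V] [FiniteDimensional F V']
    (hchar : (2 : F) ≠ 0)
    (B : LinearMap.BilinForm F V) (B' : LinearMap.BilinForm F V')
    (hB : ∀ u v : V, B u v = B v u) (hB' : ∀ u v : V', B' u v = B' v u)
    (hnd : B.Nondegenerate) (hnd' : B'.Nondegenerate)
    (hVV' : AreIsometric B B')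
    (Vp Vh Vm : Submodule F V) (Vp' Vh' Vm' : Submodule F V')
    (hWitt : IsWittDecomposition B Vp Vh Vm)
    (hWitt' : IsWittDecomposition B' Vp' Vh' Vm')
    -- isometric self-dual flags compatible with `V⁺`, `V'⁺`
    (k : ℕ) (𝒱 : ℕ → Submodule F V) (𝒱' : ℕ → Submodule F V')
    (h0 : 𝒱 0 = ⊥) (hk : 𝒱 k = ⊤) (hmono : ∀ i < k, 𝒱 i ≤ 𝒱 (i + 1))
    (h0' : 𝒱' 0 = ⊥) (hk' : 𝒱' k = ⊤) (hmono' : ∀ i < k, 𝒱' i ≤ 𝒱' (i + 1))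
    (hsd : ∀ i ≤ k, B.orthogonal (𝒱 i) = 𝒱 (k - i))
    (hsd' : ∀ i ≤ k, B'.orthogonal (𝒱' i) = 𝒱' (k - i))
    (hflagdim : ∀ i ≤ k, finrank F ↥(𝒱 i) = finrank F ↥(𝒱' i))
    (hcomp : 𝒱 (k / 2) ≤ Vp) (hcomp' : 𝒱' (k / 2) ≤ Vp')
    -- the isometry of subspaces
    (E : Submodule F V) (E' : Submodule F V')
    (φ : E ≃ₗ[F] E') (hφ : IsIsometryOn B B' E E' φ) :
    (∃ φV : V ≃ₗ[F] V', IsIsometry B B' φV ∧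
        (∀ e : E, φV (e : V) = (φ e : V')) ∧
        Vh.map φV.toLinearMap = Vh' ∧
        Vp.map φV.toLinearMap = Vp' ∧ Vm.map φV.toLinearMap = Vm' ∧
        ∀ i ≤ k, (𝒱 i).map φV.toLinearMap = 𝒱' i) ↔
      ((∀ e : E, (e : V) ∈ Vp ⊔ Vm ↔ (φ e : V') ∈ Vp' ⊔ Vm') ∧
       (∀ e : E, (e : V) ∈ Vm ⊔ Vh ↔ (φ e : V') ∈ Vm' ⊔ Vh') ∧
       (∀ e : E, (e : V) ∈ Vh ⊔ Vp ↔ (φ e : V') ∈ Vh' ⊔ Vp') ∧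
       ∃ ψ : ↥(Pproj3 Vp Vh Vm E) ≃ₗ[F] ↥(Pproj3 Vp' Vh' Vm' E'),
         -- `ψ` is the induced map `φ̃_{V⁺,V̂,V⁻}`
         (∀ (v vA vB vC : V) (hv : v ∈ E), vA ∈ Vp → vB ∈ Vh → vC ∈ Vm →
           v = vA + vB + vC →
           ∀ (vA' vB' vC' : V'), vA' ∈ Vp' → vB' ∈ Vh' → vC' ∈ Vm' →
             (φ ⟨v, hv⟩ : V') = vA' + vB' + vC' →
           ∀ (hAP : vA ∈ Pproj3 Vp Vh Vm E) (hBP : vB ∈ Pproj3 Vp Vh Vm E)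
             (hCP : vC ∈ Pproj3 Vp Vh Vm E)
             (hAP' : vA' ∈ Pproj3 Vp' Vh' Vm' E')
             (hBP' : vB' ∈ Pproj3 Vp' Vh' Vm' E')
             (hCP' : vC' ∈ Pproj3 Vp' Vh' Vm' E'),
             ψ ⟨vA, hAP⟩ = ⟨vA', hAP'⟩ ∧ ψ ⟨vB, hBP⟩ = ⟨vB', hBP'⟩ ∧
               ψ ⟨vC, hCP⟩ = ⟨vC', hCP'⟩) ∧
         -- `ψ` is an isometry
         IsIsometryOn B B' (Pproj3 Vp Vh Vm E) (Pproj3 Vp' Vh' Vm' E') ψ ∧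
         -- `ψ` sends `P ∩ Vᵢ` to `P' ∩ Vᵢ'`
         (∀ i, 1 ≤ i → i ≤ k → ∀ x : ↥(Pproj3 Vp Vh Vm E),
           (x : V) ∈ 𝒱 i ↔ (ψ x : V') ∈ 𝒱' i)) := by
  constructor
  · rintro ⟨ρ, hρ, hρE, hρh, hρp, hρm, hρ𝒱⟩
    have hmem : ∀ {N : Submodule F V} {N' : Submodule F V'}, N.map ρ.toLinearMap = N' →
        ∀ x, x ∈ N ↔ ρ x ∈ N' := by
      rintro N _ rfl x
      exact ⟨fun hx => Submodule.mem_map_of_mem hx, fun ⟨y, hy, e⟩ => ρ.injective e ▸ hy⟩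
    have hE : E.map ρ.toLinearMap = E' := by
      apply le_antisymm
      · rintro _ ⟨e, he, rfl⟩
        exact (hρE ⟨e, he⟩) ▸ (φ ⟨e, he⟩).2
      · intro e' he'
        refine ⟨φ.symm ⟨e', he'⟩, (φ.symm ⟨e', he'⟩).2, ?_⟩
        exact (hρE _).trans (by simp)
    have hP : (Pproj3 Vp Vh Vm E).map ρ.toLinearMap = Pproj3 Vp' Vh' Vm' E' := by
      rw [Pproj3_map ρ.toLinearMap ρ.injective, hρp, hρh, hρm, hE]
    refine ⟨fun e => ?_, fun e => ?_, fun e => ?_,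
      (ρ.submoduleMap _).trans (LinearEquiv.ofEq _ _ hP), ?_, fun u v => hρ u v,
      fun i _ hi x => hmem (hρ𝒱 i hi) x⟩
    · rw [← hρE]
      exact hmem (by rw [Submodule.map_sup, hρp, hρm]) e
    · rw [← hρE]
      exact hmem (by rw [Submodule.map_sup, hρh, hρm]) e
    · rw [← hρE]
      exact hmem (by rw [Submodule.map_sup, hρp, hρh]) e
    · intro v a b c hv ha hb hc hvabc a' b' c' ha' hb' hc' hφv _ _ _ _ _ _
      obtain ⟨h1, h2, h3⟩ := hWitt'.add_inj ((hmem hρp a).1 ha) ((hmem hρh b).1 hb)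
        ((hmem hρm c).1 hc) ha' hb' hc' (by
          rw [← hφv, ← map_add, ← map_add, ← hvabc]
          exact hρE ⟨v, hv⟩)
      exact ⟨Subtype.ext h1, Subtype.ext h2, Subtype.ext h3⟩
  · rintro ⟨-, -, -, ψ, hψ, hψB, hψ𝒱⟩
    obtain ⟨f, hf⟩ := LinearMap.exists_extend
      ((Pproj3 Vp' Vh' Vm' E').subtype ∘ₗ ψ.toLinearMap)
    have hfψ : ∀ x : Pproj3 Vp Vh Vm E, f x = ψ x := fun x => LinearMap.congr_fun hf x
    have hfB : ∀ u ∈ Pproj3 Vp Vh Vm E, ∀ v ∈ Pproj3 Vp Vh Vm E, B' (f u) (f v) = B u v :=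
      fun u hu v hv => by rw [hfψ ⟨u, hu⟩, hfψ ⟨v, hv⟩, hψB]
    have hf𝒱 : ∀ x ∈ Pproj3 Vp Vh Vm E, ∀ i ≤ k, x ∈ 𝒱 i ↔ f x ∈ 𝒱' i := by
      intro x hx i hi
      rw [hfψ ⟨x, hx⟩]
      rcases Nat.eq_zero_or_pos i with rfl | hi0
      · simp [h0, h0']
      · exact hψ𝒱 i hi0 hi ⟨x, hx⟩
    have hXP : (E ⊔ Vh ⊔ Vm) ⊓ Vp ≤ Pproj3 Vp Vh Vm E := le_sup_left.trans le_sup_left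
    have hHP : (E ⊔ Vm ⊔ Vp) ⊓ Vh ≤ Pproj3 Vp Vh Vm E := le_sup_right.trans le_sup_left
    have hDP : (E ⊔ Vp ⊔ Vh) ⊓ Vm ≤ Pproj3 Vp Vh Vm E := le_sup_right
    have hfE : ∀ (v : V) (hv : v ∈ E), ∀ a ∈ Vp, ∀ b ∈ Vh, ∀ c ∈ Vm, v = a + b + c →
        (φ ⟨v, hv⟩ : V') = f a + f b + f c ∧ f a ∈ Vp' ∧ f b ∈ Vh' ∧ f c ∈ Vm' := by
      intro v hv a ha b hb c hc hvabc
      obtain ⟨a', ha', b', hb', c', hc', he⟩ := hWitt'.exists_eq_add (φ ⟨v, hv⟩)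
      obtain ⟨haX, hbH, hcD⟩ := mem_Pproj3_of_mem hv ha hb hc hvabc
      obtain ⟨haX', hbH', hcD'⟩ := mem_Pproj3_of_mem (φ ⟨v, hv⟩).2 ha' hb' hc' he
      obtain ⟨h1, h2, h3⟩ := hψ v a b c hv ha hb hc hvabc a' b' c' ha' hb' hc' he
        (hXP haX) (hHP hbH) (hDP hcD) (Submodule.mem_sup_left (Submodule.mem_sup_left haX'))
        (Submodule.mem_sup_left (Submodule.mem_sup_right hbH')) (Submodule.mem_sup_right hcD')
      have h1' : f a = a' := (hfψ ⟨a, hXP haX⟩).trans (congrArg Subtype.val h1)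
      have h2' : f b = b' := (hfψ ⟨b, hHP hbH⟩).trans (congrArg Subtype.val h2)
      have h3' : f c = c' := (hfψ ⟨c, hDP hcD⟩).trans (congrArg Subtype.val h3)
      rw [h1', h2', h3']
      exact ⟨he, ha', hb', hc'⟩
    have hfX : ∀ x ∈ (E ⊔ Vh ⊔ Vm) ⊓ Vp, f x ∈ Vp' := by
      rintro x ⟨hx, hxp⟩
      obtain ⟨b, hb, c, hc, hv⟩ := exists_of_mem_sup_sup hx
      exact (hfE _ hv x hxp b hb c hc rfl).2.1
    have hfH : ∀ x ∈ (E ⊔ Vm ⊔ Vp) ⊓ Vh, f x ∈ Vh' := by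
      rintro x ⟨hx, hxh⟩
      obtain ⟨c, hc, a, ha, hv⟩ := exists_of_mem_sup_sup hx
      exact (hfE _ hv a ha x hxh c hc (by abel)).2.2.1
    have hfD : ∀ x ∈ (E ⊔ Vp ⊔ Vh) ⊓ Vm, f x ∈ Vm' := by
      rintro x ⟨hx, hxm⟩
      obtain ⟨a, ha, b, hb, hv⟩ := exists_of_mem_sup_sup hx
      exact (hfE _ hv a ha b hb x hxm (by abel)).2.2.2
    have hdim : finrank F Vp = finrank F Vp' := by
      refine le_antisymm (hWitt.finrank_le_of_areIsometric hWitt' hB' hnd' hVV') ?_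
      refine hWitt'.finrank_le_of_areIsometric hWitt hB hnd ?_
      obtain ⟨τ, hτ⟩ := hVV'
      exact ⟨τ.symm, fun u v => by rw [← hτ, τ.apply_symm_apply, τ.apply_symm_apply]⟩
    obtain ⟨h, hhX, -, hhp, hh𝒱, hhD⟩ := hWitt.exists_extend_flag hB hB' hnd hnd' hWitt' hdim
      h0 hmono h0' hmono' hsd hsd' hflagdim hcomp hcomp' inf_le_right inf_le_right f hfX hfD
      (fun x hx d hd => hfB x (hXP hx) d (hDP hd)) (fun x hx => hf𝒱 x (hXP hx))
      fun x hx => hf𝒱 x (hDP hx)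
    obtain ⟨g, hg⟩ := hWitt'.exists_dual_map (B := B) hB' hnd' hdim h hhp
    have hgD : ∀ d ∈ (E ⊔ Vp ⊔ Vh) ⊓ Vm, g d = f d := by
      intro d hd
      rw [← sub_eq_zero]
      refine hWitt'.swap.eq_zero_of_forall hB' hnd' (Vm'.sub_mem (hg d).1 (hfD d hd)) ?_
      rw [← hhp]
      rintro _ ⟨u, hu, rfl⟩
      rw [hB', map_sub, (hg d).2 u hu, hhD u hu d hd, sub_self]
    obtain ⟨ρ, hρ, hρp, hρh, hρm⟩ := hWitt.exists_isometry_extend hchar hB hB' hnd hVV' hWitt'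
      ((E ⊔ Vm ⊔ Vp) ⊓ Vh) inf_le_right h g f
      (fun u hu => hhp ▸ Submodule.mem_map_of_mem hu) (fun u _ => (hg u).1) hfH
      (fun u hu v _ => (hg v).2 u hu) fun u hu v hv => hfB u (hHP hu) v (hHP hv)
    have hmapp : Vp.map ρ.toLinearMap = Vp' := by
      rw [← hhp]
      exact Submodule.map_eq_map_of_forall_eq hρp
    have hmapm : Vm.map ρ.toLinearMap = Vm' := by
      refine Submodule.eq_of_le_of_finrank_eq ?_ ?_
      · rintro _ ⟨u, hu, rfl⟩
        exact (hρm u hu).symm ▸ (hg u).1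
      · rw [← hWitt'.dim_eq, ← hdim, hWitt.dim_eq]
        exact LinearEquiv.finrank_map_eq ρ Vm
    have hmap𝒱 : ∀ i ≤ k / 2, (𝒱 i).map ρ.toLinearMap = 𝒱' i := by
      intro i hi
      rw [← hh𝒱 i hi]
      exact Submodule.map_eq_map_of_forall_eq fun x hx =>
        hρp x (hcomp (le_of_le_of_forall_le_succ hmono hi (by omega) hx))
    refine ⟨ρ, hρ, fun e => ?_,
      hWitt.map_eq_of_isometry hB hB' hnd hnd' hWitt' hρ hmapp hmapm, hmapp, hmapm,
      fun i hi => ?_⟩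
    · obtain ⟨a, ha, b, hb, c, hc, he⟩ := hWitt.exists_eq_add (e : V)
      obtain ⟨haX, hbH, hcD⟩ := mem_Pproj3_of_mem e.2 ha hb hc he
      rw [(hfE e e.2 a ha b hb c hc he).1, he, map_add, map_add, hρp a ha, hhX a haX,
        hρh b hbH, hρm c hc, hgD c hcD]
    · by_cases hi2 : i ≤ k / 2
      · exact hmap𝒱 i hi2
      · have h1 := hsd (k - i) (by omega)
        have h2 := hsd' (k - i) (by omega)
        rw [Nat.sub_sub_self hi] at h1 h2
        rw [← h1, ← h2, map_orthogonal hρ, hmap𝒱 (k - i) (by omega)]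
end

section
/- Let (V,b) ≈ (V',b') be nonsingular finite-dimensional metric spaces over F, let E, A ⊆ V and E', A' ⊆ V' be subspaces, and let φ : E → E' be an isometry satisfying φ(E ∩ (A+A^⊥)) = E' ∩ (A'+A'^⊥), φ(E ∩ A) = E' ∩ A', and φ(E ∩ A^⊥) = E' ∩ A'^⊥. Then there is a well-defined linear bijection φ_A : ((E+A^⊥) ∩ A)/(A^⊥ ∩ A) → ((E'+A'^⊥) ∩ A')/(A'^⊥ ∩ A') such that whenever v ∈ A, e ∈ E, a_⊥ ∈ A^⊥ satisfy v = e − a_⊥, and φ(e) = v' + a'_⊥ with v' ∈ A', a'_⊥ ∈ A'^⊥, one has φ_A(v + (A^⊥ ∩ A)) = v' + (A'^⊥ ∩ A'). -/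
open Module

open Module Witt

/-- Surjective linear maps with corresponding kernels induce an equivalence of their targets. -/
theorem exists_linearEquiv_of_surjective_of_ker {F M M' Q Q' : Type*} [Field F]
    [AddCommGroup M] [Module F M] [AddCommGroup M'] [Module F M']
    [AddCommGroup Q] [Module F Q] [AddCommGroup Q'] [Module F Q']
    (g : M →ₗ[F] Q) (g' : M' →ₗ[F] Q') (hg : Function.Surjective g)
    (hg' : Function.Surjective g') (θ : M ≃ₗ[F] M') (h : ∀ x, g x = 0 ↔ g' (θ x) = 0) :
    ∃ ψ : Q ≃ₗ[F] Q', ∀ x, ψ (g x) = g' (θ x) := by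
  have hker : (LinearMap.ker g).map (θ : M →ₗ[F] M') = LinearMap.ker g' := by
    ext y
    simp only [Submodule.mem_map, LinearMap.mem_ker]
    constructor
    · rintro ⟨x, hx, rfl⟩
      exact (h x).1 hx
    · intro hy
      exact ⟨θ.symm y, (h _).2 (by simpa using hy), by simp⟩
  refine ⟨(g.quotKerEquivOfSurjective hg).symm.trans
    ((Submodule.Quotient.equiv _ _ θ hker).trans (g'.quotKerEquivOfSurjective hg')), fun x => ?_⟩
  have hx : (g.quotKerEquivOfSurjective hg).symm (g x) = Submodule.Quotient.mk x := by
    rw [LinearEquiv.symm_apply_eq]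
    rfl
  rw [LinearEquiv.trans_apply, hx]
  rfl

/-- The map sending `v + a ∈ E ∩ (A + P)`, with `v ∈ A` and `a ∈ P`, to the class of `v` in
`((E + P) ∩ A) / (P ∩ A)`. -/
theorem Submodule.exists_component_quotient_map {F V : Type*} [Field F]
    [AddCommGroup V] [Module F V] (E A P : Submodule F V) :
    ∃ g : ↥((A ⊔ P).comap E.subtype) →ₗ[F]
        (↥((E ⊔ P) ⊓ A) ⧸ (P ⊓ A).comap ((E ⊔ P) ⊓ A).subtype),
      Function.Surjective g ∧ (∀ x, g x = 0 ↔ (x : V) ∈ P) ∧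
      ∀ (x : ↥((A ⊔ P).comap E.subtype)) (v : V) (hv : v ∈ (E ⊔ P) ⊓ A), (x : V) - v ∈ P →
        g x = Submodule.Quotient.mk ⟨v, hv⟩ := by
  have hex (x : ↥((A ⊔ P).comap E.subtype)) : ∃ v : ↥((E ⊔ P) ⊓ A), (x : V) - v ∈ P := by
    obtain ⟨v, hv, a, ha, hva⟩ := Submodule.mem_sup.1 x.2
    have hva' : v + a = (x : V) := hva
    refine ⟨⟨v, Submodule.mem_sup.2 ⟨x, x.1.2, -a, P.neg_mem ha, ?_⟩, hv⟩, ?_⟩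
    · rw [← hva']; abel
    · simpa [sub_eq_iff_eq_add'.2 hva'.symm] using ha
  choose f hf using hex
  have key (x y : ↥((E ⊔ P) ⊓ A)) (hxy : (x : V) - y ∈ P) :
      (Submodule.Quotient.mk x : ↥((E ⊔ P) ⊓ A) ⧸ (P ⊓ A).comap ((E ⊔ P) ⊓ A).subtype) =
        Submodule.Quotient.mk y :=
    (Submodule.Quotient.eq _).2 ⟨hxy, A.sub_mem x.2.2 y.2.2⟩
  have huniq (x : ↥((A ⊔ P).comap E.subtype)) (v : ↥((E ⊔ P) ⊓ A)) (hv : (x : V) - v ∈ P) :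
      (Submodule.Quotient.mk (f x) :
        ↥((E ⊔ P) ⊓ A) ⧸ (P ⊓ A).comap ((E ⊔ P) ⊓ A).subtype) = Submodule.Quotient.mk v := by
    refine key _ _ ?_
    convert P.sub_mem hv (hf x) using 1
    abel
  refine ⟨{ toFun := fun x => Submodule.Quotient.mk (f x)
            map_add' := fun x y => huniq _ (f x + f y) ?_
            map_smul' := fun c x => huniq _ (c • f x) ?_ }, ?_, fun x => ?_, fun x v hv hx => ?_⟩
  · convert P.add_mem (hf x) (hf y) using 1
    push_cast
    abel
  · convert P.smul_mem c (hf x) using 1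
    push_cast
    rw [smul_sub]
  · intro q
    obtain ⟨⟨v, hvE, hvA⟩, rfl⟩ := Submodule.Quotient.mk_surjective _ q
    obtain ⟨e, he, a, ha, rfl⟩ := Submodule.mem_sup.1 hvE
    refine ⟨⟨⟨e, he⟩, Submodule.mem_sup.2 ⟨e + a, hvA, -a, P.neg_mem ha, ?_⟩⟩, huniq _ _ ?_⟩
    · simp
    · simpa using ha
  · change (Submodule.Quotient.mk (f x) :
      ↥((E ⊔ P) ⊓ A) ⧸ (P ⊓ A).comap ((E ⊔ P) ⊓ A).subtype) = 0 ↔ _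
    rw [Submodule.Quotient.mk_eq_zero]
    constructor
    · intro h
      simpa using P.add_mem (hf x) h.1
    · intro h
      refine ⟨?_, (f x).2.2⟩
      simpa using P.sub_mem h (hf x)
  · exact huniq x ⟨v, hv⟩ hx

/-- Lemma 5.1: under conditions (C2), (C3), (C4), there is a well-defined
linear bijection
`φ_A : ((E+A^⊥) ∩ A)/(A^⊥ ∩ A) → ((E'+A'^⊥) ∩ A')/(A'^⊥ ∩ A')`
determined by `φ_A(v + (A^⊥ ∩ A)) = v' + (A'^⊥ ∩ A')` whenever `v = e - a⊥`
with `e ∈ E`, `a⊥ ∈ A^⊥`, and `φ(e) = v' + a'⊥` with `v' ∈ A'`,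
`a'⊥ ∈ A'^⊥`. -/
theorem witt_induced_quotient_map_exists {F V V' : Type*} [Field F]
    [AddCommGroup V] [Module F V] [AddCommGroup V'] [Module F V']
    [FiniteDimensional F V] [FiniteDimensional F V']
    (hchar : (2 : F) ≠ 0)
    (B : LinearMap.BilinForm F V) (B' : LinearMap.BilinForm F V')
    (hB : ∀ u v : V, B u v = B v u) (hB' : ∀ u v : V', B' u v = B' v u)
    (hnd : B.Nondegenerate) (hnd' : B'.Nondegenerate)
    (hVV' : AreIsometric B B')
    (E A : Submodule F V) (E' A' : Submodule F V')
    (φ : E ≃ₗ[F] E') (hφ : IsIsometryOn B B' E E' φ)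
    (hC2 : ∀ e : E, (e : V) ∈ A ⊔ B.orthogonal A ↔
      (φ e : V') ∈ A' ⊔ B'.orthogonal A')
    (hC3 : ∀ e : E, (e : V) ∈ A ↔ (φ e : V') ∈ A')
    (hC4 : ∀ e : E, (e : V) ∈ B.orthogonal A ↔ (φ e : V') ∈ B'.orthogonal A') :
    ∃ ψ : (↥((E ⊔ B.orthogonal A) ⊓ A) ⧸
            (B.orthogonal A ⊓ A).comap ((E ⊔ B.orthogonal A) ⊓ A).subtype)
        ≃ₗ[F] (↥((E' ⊔ B'.orthogonal A') ⊓ A') ⧸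
            (B'.orthogonal A' ⊓ A').comap ((E' ⊔ B'.orthogonal A') ⊓ A').subtype),
      ∀ (v : V) (hvW : v ∈ (E ⊔ B.orthogonal A) ⊓ A)
        (e : V) (he : e ∈ E) (a : V), a ∈ B.orthogonal A → v = e - a →
        ∀ (v' : V') (hvW' : v' ∈ (E' ⊔ B'.orthogonal A') ⊓ A')
          (a' : V'), a' ∈ B'.orthogonal A' → (φ ⟨e, he⟩ : V') = v' + a' →
        ψ (Submodule.Quotient.mk ⟨v, hvW⟩) = Submodule.Quotient.mk ⟨v', hvW'⟩ := by
  obtain ⟨g, hg, hg0, hgv⟩ := E.exists_component_quotient_map A (B.orthogonal A)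
  obtain ⟨g', hg', hg0', hgv'⟩ := E'.exists_component_quotient_map A' (B'.orthogonal A')
  have hmap : ((A ⊔ B.orthogonal A).comap E.subtype).map (φ : E →ₗ[F] E') =
      (A' ⊔ B'.orthogonal A').comap E'.subtype := by
    ext y
    constructor
    · rintro ⟨x, hx, rfl⟩
      exact (hC2 x).1 hx
    · intro hy
      exact ⟨φ.symm y, (hC2 _).2 (by simpa using hy), by simp⟩
  obtain ⟨ψ, hψ⟩ := exists_linearEquiv_of_surjective_of_ker g g' hg hg'
    (φ.ofSubmodules _ _ hmap) (fun x => by rw [hg0, hg0']; exact hC4 x.1)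
  refine ⟨ψ, fun v hvW e he a ha hv v' hvW' a' ha' hφe => ?_⟩
  have heA : e ∈ A ⊔ B.orthogonal A :=
    Submodule.mem_sup.2 ⟨v, hvW.2, a, ha, by rw [hv]; abel⟩
  rw [← hgv ⟨⟨e, he⟩, heA⟩ v hvW (by simpa [hv] using ha), hψ]
  refine hgv' _ v' hvW' ?_
  change (φ ⟨e, he⟩ : V') - v' ∈ _
  rwa [hφe, add_sub_cancel_left]
end
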